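/- arXiv:2305.08466 — 3 statements merged into one kernel-verified Lean document; each statement's English description precedes it below -/
import Mathlib

section
/- For any d ∈ ℕ+ and any C, J₀, ε > 0, there exist N, L ∈ ℕ with N·L ≥ J₀ such that VCdim(DΦ) > C · N^{2−ε} L^{2−ε}, where Φ is the class of all σ1-NNs on ℝ^d with width ≤ N and depth ≤ L and DΦ := {D_i φ : φ ∈ Φ, i = 1,…,d}. -/
open MeasureTheory ENNReal

noncomputable section

/-- ReLU activation. -/
def relu (x : ℝ) : ℝ := max 0 x

/-- Forward pass of a feedforward network: `n` gives layer widths, `W`/`b` the affine maps,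
`act i l` the activation of neuron `l` in layer `i` (applied to the outputs of hidden layers,
i.e. layers `1,…`; the input layer `0` is passed through unmodified). -/
def nnForward (n : ℕ → ℕ)
    (W : ∀ i : ℕ, Matrix (Fin (n (i+1))) (Fin (n i)) ℝ)
    (b : ∀ i : ℕ, Fin (n (i+1)) → ℝ)
    (act : ∀ i : ℕ, Fin (n i) → ℝ → ℝ) :
    (k : ℕ) → (Fin (n 0) → ℝ) → (Fin (n k) → ℝ)
  | 0, x => x
  | k+1, x => fun j =>
      (∑ l, W k j l * (if k = 0 then nnForward n W b act k x l
        else act k l (nnForward n W b act k x l))) + b k j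

/-- `f` is realized by a network with activations drawn from `S`, input dimension `d`,
hidden widths `≤ N` and depth (number of hidden layers) `≤ L`. -/
def IsNN (S : Set (ℝ → ℝ)) (d N L : ℕ) (f : (Fin d → ℝ) → ℝ) : Prop :=
  ∃ (n : ℕ → ℕ) (hd : n 0 = d) (h1 : n (L+1) = 1)
    (W : ∀ i : ℕ, Matrix (Fin (n (i+1))) (Fin (n i)) ℝ)
    (b : ∀ i : ℕ, Fin (n (i+1)) → ℝ)
    (act : ∀ i : ℕ, Fin (n i) → ℝ → ℝ),
    (∀ i : ℕ, 1 ≤ i → i ≤ L → n i ≤ N ∧ ∀ l, act i l ∈ S) ∧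
    ∀ x : Fin d → ℝ,
      f x = nnForward n W b act (L+1) (fun j => x (Fin.cast hd j)) (Fin.cast h1.symm 0)

/-- σ1-NN (ReLU network) with width ≤ N and depth ≤ L. -/
def IsReLUNet (d N L : ℕ) (f : (Fin d → ℝ) → ℝ) : Prop := IsNN {relu} d N L f

/-- σ2-NN: each hidden neuron uses an activation from {σ1, σ2}. -/
def IsSigma2NN (d N L : ℕ) (f : (Fin d → ℝ) → ℝ) : Prop :=
  IsNN {relu, fun x => (relu x)^2} d N L f

/-- Partial derivative in the `i`-th variable (a.e. defined; junk value 0 where the classical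
derivative does not exist, which for the Lipschitz functions considered agrees a.e. with the
weak derivative). -/
def pDer (d : ℕ) (i : Fin d) (f : (Fin d → ℝ) → ℝ) : (Fin d → ℝ) → ℝ :=
  fun x => fderiv ℝ f x (Pi.single i 1)

def pDerIter (d : ℕ) (i : Fin d) : ℕ → ((Fin d → ℝ) → ℝ) → ((Fin d → ℝ) → ℝ)
  | 0, f => f
  | k+1, f => pDer d i (pDerIter d i k f)

/-- Multi-index derivative `D^α`. -/
def mDer (d : ℕ) (α : Fin d → ℕ) (f : (Fin d → ℝ) → ℝ) : (Fin d → ℝ) → ℝ :=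
  (List.finRange d).foldr (fun i g => pDerIter d i (α i) g) f

def unitCube (d : ℕ) : Set (Fin d → ℝ) := Set.univ.pi fun _ => Set.Ioo (0:ℝ) 1

def cubeC (d : ℕ) : Set (Fin d → ℝ) := Set.univ.pi fun _ => Set.Icc (0:ℝ) 1

/-- The Sobolev `W^{n,∞}(Ω)` norm `max_{|α| ≤ n} ‖D^α f‖_{L^∞(Ω)}`. -/
def sobNorm (d n : ℕ) (Ω : Set (Fin d → ℝ)) (f : (Fin d → ℝ) → ℝ) : ℝ≥0∞ :=
  ⨆ (α : Fin d → ℕ) (_ : ∑ i, α i ≤ n), eLpNorm (mDer d α f) ⊤ (volume.restrict Ω)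

/-- The Sobolev `W^{n,∞}(Ω)` semi-norm `max_{|α| = n} ‖D^α f‖_{L^∞(Ω)}`. -/
def sobSemiNorm (d n : ℕ) (Ω : Set (Fin d → ℝ)) (f : (Fin d → ℝ) → ℝ) : ℝ≥0∞ :=
  ⨆ (α : Fin d → ℕ) (_ : ∑ i, α i = n), eLpNorm (mDer d α f) ⊤ (volume.restrict Ω)

/-- Membership in `W^{n,∞}(Ω)`: derivatives up to order `n` exist a.e. and are essentially
bounded. -/
def MemW (d n : ℕ) (Ω : Set (Fin d → ℝ)) (f : (Fin d → ℝ) → ℝ) : Prop :=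
  (∀ α : Fin d → ℕ, ∑ i, α i < n →
    ∀ᵐ x ∂(volume.restrict Ω), DifferentiableAt ℝ (mDer d α f) x) ∧
  sobNorm d n Ω f ≠ ⊤

/-- The class of first partial derivatives of ReLU networks of width ≤ N, depth ≤ L. -/
def DPhi (d N L : ℕ) : Set ((Fin d → ℝ) → ℝ) :=
  {ψ | ∃ φ, IsReLUNet d N L φ ∧ ∃ i : Fin d, ψ = pDer d i φ}

/-- `G` VC-shatters `m` points (shattering in the sense of signs `1[f(x)>0]`). -/
def VCShatters {X : Type*} (G : Set (X → ℝ)) (m : ℕ) : Prop :=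
  ∃ x : Fin m → X, ∀ b : Fin m → Bool, ∃ f ∈ G, ∀ i, (0 < f (x i) ↔ b i = true)

/-- `G` pseudo-shatters `m` points. -/
def PShatters {X : Type*} (G : Set (X → ℝ)) (m : ℕ) : Prop :=
  ∃ (x : Fin m → X) (y : Fin m → ℝ),
    ∀ b : Fin m → Bool, ∃ f ∈ G, ∀ i, (y i < f (x i) ↔ b i = true)



/-- The trapezoid partition-of-unity function `g_1` (1/K-periodic). -/
def g1 (K : ℕ) (x : ℝ) : ℝ :=
  max 0 (min 1 (min (4 * Int.fract ((K:ℝ) * x)) (3 - 4 * Int.fract ((K:ℝ) * x))))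

def g2 (K : ℕ) (x : ℝ) : ℝ := g1 K (x + 1/(2*(K:ℝ)))

/-- Select `g_1` or `g_2`: `false ↦ g_1`, `true ↦ g_2` (encoding `m_j ∈ {1,2}`). -/
def gsel (K : ℕ) (b : Bool) : ℝ → ℝ := if b then g2 K else g1 K

def gm (K d : ℕ) (m : Fin d → Bool) (x : Fin d → ℝ) : ℝ := ∏ j, gsel K (m j) (x j)

def Omega1 (K : ℕ) : Set ℝ :=
  ⋃ i ∈ Finset.range K, Set.Icc ((i:ℝ)/K) ((i:ℝ)/K + 3/(4*(K:ℝ)))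

def Omega2 (K : ℕ) : Set ℝ :=
  ⋃ i ∈ Finset.range (K+1),
    (Set.Icc ((i:ℝ)/K - 1/(2*(K:ℝ))) ((i:ℝ)/K + 1/(4*(K:ℝ))) ∩ Set.Icc 0 1)

def OmegaSel (K : ℕ) (b : Bool) : Set ℝ := if b then Omega2 K else Omega1 K

def OmegaM (K d : ℕ) (m : Fin d → Bool) : Set (Fin d → ℝ) :=
  Set.univ.pi fun j => OmegaSel K (m j)

/-- `K = ⌊N^{1/d}⌋² ⌊L^{2/d}⌋`. -/
def Kdef (N L d : ℕ) : ℕ :=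
  (⌊(N:ℝ) ^ ((1:ℝ)/(d:ℝ))⌋₊)^2 * ⌊(L:ℝ) ^ ((2:ℝ)/(d:ℝ))⌋₊

/-- `K = ⌊N^{1/d}⌋ ⌊L^{2/d}⌋`. -/
def Kdef1 (N L d : ℕ) : ℕ :=
  ⌊(N:ℝ) ^ ((1:ℝ)/(d:ℝ))⌋₊ * ⌊(L:ℝ) ^ ((2:ℝ)/(d:ℝ))⌋₊

/-- Multi-indices `α : Fin d → ℕ` with `|α| ≤ k`. -/
def MIdx (d k : ℕ) : Finset (Fin d → ℕ) :=
  (Fintype.piFinset fun _ : Fin d => Finset.range (k+1)).filter fun α => ∑ i, α i ≤ k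

/-- `α! = α_1! ⋯ α_d!`. -/
def mfact (d : ℕ) (α : Fin d → ℕ) : ℕ := ∏ i, (α i).factorial

/-- Monomial `x^α`. -/
def mono (d : ℕ) (α : Fin d → ℕ) (x : Fin d → ℝ) : ℝ := ∏ j, x j ^ α j

/-- The cell `Ω_{m,i}` (with the indicator read as `1_{m_j = 2}`). -/
def cell (K d : ℕ) (m : Fin d → Bool) (i : Fin d → ℕ) : Set (Fin d → ℝ) :=
  cubeC d ∩ Set.univ.pi fun j =>
    Set.Icc ((2*(i j : ℝ) - (if m j then 1 else 0))/(2*(K:ℝ)))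
            ((3 + 4*(i j : ℝ) - 2*(if m j then 1 else 0))/(4*(K:ℝ)))

/-- Closed Euclidean ball in `Fin d → ℝ`. -/
def eball (d : ℕ) (x₀ : Fin d → ℝ) (r : ℝ) : Set (Fin d → ℝ) :=
  {x | Real.sqrt (∑ i, (x i - x₀ i)^2) ≤ r}

/-- The (unnormalized) bump weight used in averaged Taylor polynomials. -/
def bumpW (d : ℕ) (x₀ : Fin d → ℝ) (r : ℝ) (x : Fin d → ℝ) : ℝ :=
  if Real.sqrt (∑ i, (x i - x₀ i)^2) < r then
    Real.exp (-(1 - (Real.sqrt (∑ i, (x i - x₀ i)^2) / r)^2)⁻¹)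
  else 0

/-- The normalized bump `b_r`. -/
def bumpN (d : ℕ) (x₀ : Fin d → ℝ) (r : ℝ) (x : Fin d → ℝ) : ℝ :=
  bumpW d x₀ r x / ∫ y, bumpW d x₀ r y

/-- Taylor polynomial `T^n_y f (x)` of order `n` (degree `≤ n − 1`). -/
def taylorPoly (d n : ℕ) (f : (Fin d → ℝ) → ℝ) (y x : Fin d → ℝ) : ℝ :=
  ∑ α ∈ MIdx d (n-1), (1/(mfact d α : ℝ)) * mDer d α f y * ∏ j, (x j - y j) ^ (α j)

/-- Averaged Taylor polynomial `Q^n f` of `f` over the ball `B_r(x₀)`. -/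
def QTaylor (d n : ℕ) (f : (Fin d → ℝ) → ℝ) (x₀ : Fin d → ℝ) (r : ℝ)
    (x : Fin d → ℝ) : ℝ :=
  ∫ y in eball d x₀ r, taylorPoly d n f y x * bumpN d x₀ r y

/-- The piecewise-quadratic bump `s`. -/
def sfun (x : ℝ) : ℝ :=
  if x < 0 then 0
  else if x ≤ 1/2 then 2*x^2
  else if x ≤ 1 then -2*(x-1)^2 + 1
  else if x ≤ 2 then 1
  else if x ≤ 5/2 then -2*(x-2)^2 + 1
  else if x ≤ 3 then 2*(x-3)^2
  else 0

def s1 (K : ℕ) (x : ℝ) : ℝ := ∑ i ∈ Finset.range (K+1), sfun (4*(K:ℝ)*x + 1 - 4*(i:ℝ))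

def s2 (K : ℕ) (x : ℝ) : ℝ := s1 K (x + 1/(2*(K:ℝ)))

def ssel (K : ℕ) (b : Bool) : ℝ → ℝ := if b then s2 K else s1 K

def sm (K d : ℕ) (m : Fin d → Bool) (x : Fin d → ℝ) : ℝ := ∏ j, ssel K (m j) (x j)

/-- Population risk `R_D(θ)` for target `f` and hypothesis `φ`. -/
def popRisk (d : ℕ) (f φ : (Fin d → ℝ) → ℝ) : ℝ :=
  ∫ x in unitCube d,
    ((∑ i, (pDer d i (fun y => f y - φ y) x)^2) + (f x - φ x)^2)

/-- Empirical risk `R_S(θ)` over the sample `X`. -/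
def empRisk (d M : ℕ) (f φ : (Fin d → ℝ) → ℝ) (X : Fin M → (Fin d → ℝ)) : ℝ :=
  (1/(M:ℝ)) * ∑ k, ((∑ i, (pDer d i (fun y => f y - φ y) (X k))^2)
    + (f (X k) - φ (X k))^2)

/-- Law of `M` i.i.d. samples uniform on `(0,1)^d`. -/
def sampleMeasure (d M : ℕ) : Measure (Fin M → (Fin d → ℝ)) :=
  Measure.pi fun _ => volume.restrict (unitCube d)

/-- The class `Φ̃`. -/
def PhiTilde (d N L : ℕ) (B C₁ C₂ : ℝ) : Set ((Fin d → ℝ) → ℝ) :=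
  {φ | (∃ W D : ℕ, (W:ℝ) ≤ C₁ * N * Real.log N ∧ (D:ℝ) ≤ C₂ * L * Real.log L
        ∧ IsReLUNet d W D φ) ∧ sobNorm d 1 (unitCube d) φ ≤ ENNReal.ofReal B}

/-- The class `DΦ̃` of first partial derivatives of members of `Φ̃`. -/
def DPhiTilde (d N L : ℕ) (B C₁ C₂ : ℝ) : Set ((Fin d → ℝ) → ℝ) :=
  {ψ | ∃ φ ∈ PhiTilde d N L B C₁ C₂, ∃ i : Fin d, ψ = pDer d i φ}

/-- Expected Rademacher complexity of `F` over `M` i.i.d. uniform samples on `(0,1)^d`. -/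
def radComp (d M : ℕ) (F : Set ((Fin d → ℝ) → ℝ)) : ℝ :=
  ∫ X, ((2^M : ℝ)⁻¹ * ∑ σ : Fin M → Bool,
      (1/(M:ℝ)) * sSup ((fun f => ∑ i, (if σ i then (1:ℝ) else -1) * f (X i)) '' F))
    ∂(sampleMeasure d M)

lemma twoLayer_fin (d p q N : ℕ) (hp : p ≤ N) (hq : q ≤ N)
    (a0 : Fin p → Fin d → ℝ) (c0 : Fin p → ℝ) (a1 : Fin q → Fin p → ℝ) (c1 : Fin q → ℝ)
    (a2 : Fin q → ℝ) :
    IsReLUNet d N 2 (fun x => ∑ k, a2 k * relu (∑ l, a1 k l * relu (∑ i, a0 l i * x i + c0 l)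
      + c1 k)) := by
  let n : ℕ → ℕ := fun | 0 => d | 1 => p | 2 => q | _ => 1
  let W : ∀ i : ℕ, Matrix (Fin (n (i+1))) (Fin (n i)) ℝ :=
    fun | 0 => a0 | 1 => a1 | 2 => (fun _ k => a2 k) | _+3 => fun _ _ => 0
  let b : ∀ i : ℕ, Fin (n (i+1)) → ℝ :=
    fun | 0 => c0 | 1 => c1 | 2 => (fun _ => 0) | _+3 => fun _ => 0
  refine ⟨n, rfl, rfl, W, b, fun _ _ => relu, ?_, ?_⟩
  · intro i h1 h2
    refine ⟨?_, fun _ => rfl⟩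
    interval_cases i
    · exact hp
    · exact hq
  · intro x
    simp only [nnForward]
    simp [n, W, b]
    rfl

lemma twoLayer {ι κ : Type} [Fintype ι] [Fintype κ] (d N : ℕ)
    (hp : Fintype.card ι ≤ N) (hq : Fintype.card κ ≤ N)
    (a0 : ι → Fin d → ℝ) (c0 : ι → ℝ) (a1 : κ → ι → ℝ) (c1 : κ → ℝ) (a2 : κ → ℝ) :
    IsReLUNet d N 2 (fun x => ∑ k, a2 k * relu (∑ l, a1 k l * relu (∑ i, a0 l i * x i + c0 l)
      + c1 k)) := by
  have e := Fintype.equivFin ι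
  have e' := Fintype.equivFin κ
  have := twoLayer_fin d _ _ N hp hq (fun l => a0 (e.symm l)) (fun l => c0 (e.symm l))
    (fun k l => a1 (e'.symm k) (e.symm l)) (fun k => c1 (e'.symm k)) (fun k => a2 (e'.symm k))
  convert this using 2 with x
  rw [← Equiv.sum_comp e'.symm]
  refine Finset.sum_congr rfl fun k _ => ?_
  rw [← Equiv.sum_comp e.symm]

def dlt (τ : ℕ → ℝ) (j : ℕ) : ℝ := τ j - (if j = 0 then 0 else τ (j-1))

lemma sum_dlt (τ : ℕ → ℝ) (J : ℕ) : ∑ j ∈ Finset.range (J+1), dlt τ j = τ J := by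
  induction J with
  | zero => simp [dlt]
  | succ J ih => rw [Finset.sum_range_succ, ih]; simp [dlt]

def GG (M : ℕ) (τ : ℕ → ℝ) (y : ℝ) : ℝ :=
  relu (y+1) - 1 - ∑ j : Fin M, dlt τ j *
    (2 * relu (y - ((j:ℕ) * M - 3/4)) - 2 * relu (y - ((j:ℕ) * M - 1/4)))

lemma relu_pos {x : ℝ} (h : 0 ≤ x) : relu x = x := max_eq_right h
lemma relu_neg {x : ℝ} (h : x ≤ 0) : relu x = 0 := max_eq_left h

lemma GG_eq (M i : ℕ) (hi : i < M * M) (τ : ℕ → ℝ) (y : ℝ) (hy : |y - i| < 1/4) :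
    GG M τ y = y - τ (i / M) := by
  have hM : 0 < M := by
    rcases Nat.eq_zero_or_pos M with h | h
    · simp [h] at hi
    · exact h
  rw [abs_lt] at hy
  have hi0 : (0:ℝ) ≤ i := Nat.cast_nonneg i
  unfold GG
  rw [relu_pos (by linarith)]
  have key : ∀ j : ℕ, dlt τ j *
      (2 * relu (y - ((j:ℕ) * M - 3/4)) - 2 * relu (y - ((j:ℕ) * M - 1/4))) =
      if j < i / M + 1 then dlt τ j else 0 := by
    intro j
    split_ifs with h
    · have h1 : j * M ≤ i := (Nat.le_div_iff_mul_le hM).1 (by omega)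
      have h2 : (j:ℝ) * M ≤ i := by exact_mod_cast h1
      rw [relu_pos (by linarith), relu_pos (by linarith)]; ring
    · have h1 : i < j * M := (Nat.div_lt_iff_lt_mul hM).1 (by omega)
      have h2 : (i:ℝ) + 1 ≤ j * M := by exact_mod_cast h1
      rw [relu_neg (by linarith), relu_neg (by linarith)]; ring
  rw [Fin.sum_univ_eq_sum_range (fun j => dlt τ j *
      (2 * relu (y - ((j:ℕ) * M - 3/4)) - 2 * relu (y - ((j:ℕ) * M - 1/4)))) M,
    Finset.sum_congr rfl (fun j _ => key j), ← Finset.sum_filter]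
  have : (Finset.range M).filter (fun j => j < i / M + 1) = Finset.range (i / M + 1) := by
    have : i / M < M := (Nat.div_lt_iff_lt_mul hM).2 hi
    ext j; simp; omega
  rw [this, sum_dlt]; ring

def TT (M : ℕ) (B : ℕ → ℝ) (l j : ℕ) : ℝ := j * M + l + 1/2 - B (j * M + l)

def FF (M : ℕ) (B : ℕ → ℝ) (y : ℝ) : ℝ :=
  ∑ l : Fin M, (relu (GG M (TT M B l) y) - relu (GG M (TT M (fun _ => 0) l) y))

lemma FF_deriv (M i : ℕ) (hi : i < M * M) (B : ℕ → ℝ) (hB : ∀ i, B i = 0 ∨ B i = 1) :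
    HasDerivAt (FF M B) (B i) i := by
  have hM : 0 < M := by
    rcases Nat.eq_zero_or_pos M with h | h
    · simp [h] at hi
    · exact h
  have hkM : i % M < M := Nat.mod_lt _ hM
  have hdm : i / M * M + i % M = i := Nat.div_add_mod' i M
  have hdm' : ((i / M : ℕ) : ℝ) * M + ((i % M : ℕ) : ℝ) = i := by exact_mod_cast hdm
  have key : ∀ l : Fin M, ∃ c : ℝ, ∀ y : ℝ, |y - i| < 1/4 →
      relu (GG M (TT M B l) y) - relu (GG M (TT M (fun _ => 0) l) y) =
      c + (if l = ⟨i % M, hkM⟩ then B i else 0) * (y - i) := by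
    intro l
    have h01 := hB (i / M * M + l)
    rcases lt_trichotomy (l:ℕ) (i % M) with h | h | h
    · refine ⟨B (i / M * M + l), fun y hy => ?_⟩
      rw [GG_eq M i hi _ y hy, GG_eq M i hi _ y hy]
      have hl : l ≠ ⟨i % M, hkM⟩ := by intro h'; rw [h'] at h; simp at h
      have h' : ((l:ℕ):ℝ) + 1 ≤ ((i % M : ℕ) : ℝ) := by exact_mod_cast h
      rw [abs_lt] at hy
      simp only [TT, if_neg hl]
      rw [relu_pos, relu_pos]
      · ring
      · linarith
      · rcases h01 with h0 | h0 <;> rw [h0] <;> linarith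
    · refine ⟨B i / 2, fun y hy => ?_⟩
      rw [GG_eq M i hi _ y hy, GG_eq M i hi _ y hy]
      have hl : l = ⟨i % M, hkM⟩ := Fin.ext h
      rw [abs_lt] at hy
      simp only [TT, if_pos hl]
      rw [h, hdm] at h01
      rw [h, hdm]
      rcases h01 with h0 | h0
      · rw [h0]; simp
      · rw [h0, relu_pos, relu_neg]
        · linarith
        · linarith
        · linarith
    · refine ⟨0, fun y hy => ?_⟩
      rw [GG_eq M i hi _ y hy, GG_eq M i hi _ y hy]
      have hl : l ≠ ⟨i % M, hkM⟩ := by intro h'; rw [h'] at h; simp at h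
      have h' : ((i % M : ℕ) : ℝ) + 1 ≤ ((l:ℕ):ℝ) := by exact_mod_cast h
      rw [abs_lt] at hy
      simp only [TT, if_neg hl]
      rw [relu_neg, relu_neg]
      · ring
      · linarith
      · rcases h01 with h0 | h0 <;> rw [h0] <;> linarith
  choose c hc using key
  have hD : HasDerivAt (fun y : ℝ => ∑ l, c l + B i * (y - i)) (B i) i := by
    simpa using (((hasDerivAt_id (i:ℝ)).sub_const (i:ℝ)).const_mul (B i)).const_add (∑ l, c l)
  refine hD.congr_of_eventuallyEq ?_
  filter_upwards [Metric.ball_mem_nhds (i:ℝ) (show (0:ℝ) < 1/4 by norm_num)] with y hy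
  rw [Metric.mem_ball, Real.dist_eq] at hy
  unfold FF
  rw [Finset.sum_congr rfl (fun l _ => hc l y hy), Finset.sum_add_distrib, ← Finset.sum_mul]
  simp

lemma FF_net (d : ℕ) (i0 : Fin d) (M : ℕ) (B : ℕ → ℝ) :
    IsReLUNet d (2*M+1) 2 (fun x => FF M B (x i0)) := by
  have := twoLayer (ι := Unit ⊕ (Fin M ⊕ Fin M)) (κ := Fin M ⊕ Fin M) d (2*M+1)
    (by simp; omega) (by simp; omega)
    (fun _ i => if i = i0 then 1 else 0)
    (Sum.elim (fun _ => 1) (Sum.elim (fun j => -((j:ℕ) * M - 3/4)) (fun j => -((j:ℕ) * M - 1/4))))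
    (Sum.elim
      (fun k => Sum.elim (fun _ => 1) (Sum.elim (fun j => -(2 * dlt (TT M B k) j))
        (fun j => 2 * dlt (TT M B k) j)))
      (fun k => Sum.elim (fun _ => 1) (Sum.elim (fun j => -(2 * dlt (TT M (fun _ => 0) k) j))
        (fun j => 2 * dlt (TT M (fun _ => 0) k) j))))
    (fun _ => -1)
    (Sum.elim (fun _ => 1) (fun _ => -1))
  convert this using 2 with x
  have hG : ∀ τ : ℕ → ℝ, GG M τ (x i0) = relu (x i0 + 1) +
      (∑ j : Fin M, -(2 * dlt τ j) * relu (x i0 + -((j:ℕ) * M - 3/4)) +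
       ∑ j : Fin M, 2 * dlt τ j * relu (x i0 + -((j:ℕ) * M - 1/4))) + -1 := by
    intro τ
    unfold GG
    rw [← Finset.sum_add_distrib]
    have hS : ∑ j : Fin M, (-(2 * dlt τ j) * relu (x i0 + -((j:ℕ) * M - 3/4)) +
        2 * dlt τ j * relu (x i0 + -((j:ℕ) * M - 1/4))) = -∑ j : Fin M, dlt τ j *
        (2 * relu (x i0 - ((j:ℕ) * M - 3/4)) - 2 * relu (x i0 - ((j:ℕ) * M - 1/4))) := by
      rw [← Finset.sum_neg_distrib]
      refine Finset.sum_congr rfl fun j _ => ?_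
      simp only [← sub_eq_add_neg]; ring
    rw [hS]; ring
  simp only [Fintype.sum_sum_type, Sum.elim_inl, Sum.elim_inr, ite_mul, one_mul, zero_mul,
    Finset.sum_ite_eq', Finset.mem_univ, if_true, Finset.univ_unique, Finset.sum_const,
    Finset.card_singleton, one_smul, ← hG]
  unfold FF
  rw [← Finset.sum_add_distrib]
  refine Finset.sum_congr rfl fun j _ => ?_
  ring

lemma DPhi_shatters (d : ℕ) (hd : 0 < d) (M : ℕ) :
    VCShatters (DPhi d (2*M+1) 2) (M*M) := by
  refine ⟨fun i _ => ((i:ℕ):ℝ), fun b => ?_⟩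
  let B : ℕ → ℝ := fun i => if h : i < M * M then (if b ⟨i, h⟩ = true then 1 else 0) else 0
  have hB : ∀ i, B i = 0 ∨ B i = 1 := by
    intro i; simp only [B]; split_ifs <;> simp
  let i0 : Fin d := ⟨0, hd⟩
  refine ⟨_, ⟨_, FF_net d i0 M B, i0, rfl⟩, fun i => ?_⟩
  have h1 := FF_deriv M i i.2 B hB
  have h2 : HasFDerivAt (fun x : Fin d → ℝ => x i0)
      (ContinuousLinearMap.proj (R := ℝ) (φ := fun _ : Fin d => ℝ) i0) (fun _ => ((i:ℕ):ℝ)) :=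
    hasFDerivAt_apply i0 _
  have h3 := HasDerivAt.comp_hasFDerivAt (fun _ : Fin d => ((i:ℕ):ℝ)) h1 h2
  have h4 : pDer d i0 (fun x => FF M B (x i0)) (fun _ => ((i:ℕ):ℝ)) = B i := by
    unfold pDer
    have := h3.fderiv
    simp only [Function.comp_def] at this
    rw [this]; simp
  rw [h4]
  simp only [B, i.2, dif_pos]
  split_ifs with h <;> simp_all

/-- Corollary 5.3: near-optimality of the VC-dimension bound for derivative classes. -/
theorem vcdim_DPhi_optimal (d : ℕ) (hd : 0 < d) (C J₀ ε : ℝ)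
    (hC : 0 < C) (hJ₀ : 0 < J₀) (hε : 0 < ε) :
    ∃ N L : ℕ, J₀ ≤ ((N*L : ℕ) : ℝ) ∧
      ∃ m : ℕ, VCShatters (DPhi d N L) m ∧
        C * (N:ℝ) ^ ((2:ℝ) - ε) * (L:ℝ) ^ ((2:ℝ) - ε) < (m : ℝ) := by
  have hlim : Filter.Tendsto (fun M : ℕ => 9 * C * (2:ℝ) ^ ((2:ℝ) - ε) *
      (((2*M+1 : ℕ) : ℝ)) ^ (-ε)) Filter.atTop (nhds 0) := by
    have h1 : Filter.Tendsto (fun M : ℕ => ((2*M+1 : ℕ) : ℝ)) Filter.atTop Filter.atTop :=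
      tendsto_natCast_atTop_atTop.comp
        (Filter.tendsto_atTop_mono (fun M => by simp only [id]; omega) Filter.tendsto_id)
    simpa using ((tendsto_rpow_neg_atTop hε).comp h1).const_mul (9 * C * (2:ℝ) ^ ((2:ℝ) - ε))
  have h2 : Filter.Tendsto (fun M : ℕ => (M : ℝ)) Filter.atTop Filter.atTop :=
    tendsto_natCast_atTop_atTop
  obtain ⟨M, hM1, hMJ, hM0⟩ := ((hlim.eventually (gt_mem_nhds one_pos)).and
    ((h2.eventually_ge_atTop J₀).and (Filter.eventually_ge_atTop 1))).exists
  have hMr : (1:ℝ) ≤ M := by exact_mod_cast hM0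
  refine ⟨2*M+1, 2, ?_, M*M, DPhi_shatters d hd M, ?_⟩
  · push_cast; linarith
  · have hN : (0:ℝ) < ((2*M+1 : ℕ) : ℝ) := by positivity
    rw [sub_eq_add_neg, Real.rpow_add hN, Real.rpow_two, ← sub_eq_add_neg]
    have hle : ((2*M+1 : ℕ) : ℝ)^2 ≤ 9 * (M*M) := by push_cast; nlinarith
    set E := ((2*M+1 : ℕ) : ℝ) ^ (-ε) with hE
    have hE0 : 0 < E := Real.rpow_pos_of_pos hN _
    have hK : (0:ℝ) < (2:ℝ) ^ ((2:ℝ) - ε) := by positivity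
    set K := (2:ℝ) ^ ((2:ℝ) - ε) with hKd
    have hK' : ((2:ℕ):ℝ) ^ ((2:ℝ) - ε) = K := by simp [hKd]
    rw [hK']
    calc C * (((2*M+1 : ℕ) : ℝ)^2 * E) * K = (C * E * K) * ((2*M+1 : ℕ) : ℝ)^2 := by ring
      _ ≤ (C * E * K) * (9 * (M*M)) := by gcongr
      _ = (9 * C * K * E) * (M*M) := by ring
      _ < 1 * (M*M) := by
        apply mul_lt_mul_of_pos_right hM1; positivity
      _ = ((M*M : ℕ) : ℝ) := by push_cast; ring

end
end

section
/- For any N, L, s ∈ ℕ+ with s ≥ 2, there exists a σ1-NN φ: ℝ^s → ℝ with width 9(N+1)+s−1 and depth 14·s·(s−1)·L such that ‖φ‖_{W^{1,∞}((0,1)^s)} ≤ 18 and ‖φ(x) − x_1 x_2 ⋯ x_s‖_{W^{1,∞}((0,1)^s)} ≤ 10(s−1)(N+1)^{−7sL}. Furthermore, for any i = 1,…,s, if x_i = 0 then φ(x_1,…,x_{i−1},0,x_{i+1},…,x_s) = 0 and ∂φ(x_1,…,x_{i−1},0,x_{i+1},…,x_s)/∂x_j = 0 for all j ≠ i. -/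
open MeasureTheory ENNReal

noncomputable section

namespace MPN

lemma relu_mono {x y : ℝ} (h : x ≤ y) : relu x ≤ relu y := max_le_max le_rfl h
lemma relu_of_nonneg {x : ℝ} (h : 0 ≤ x) : relu x = x := max_eq_right h
lemma relu_of_nonpos {x : ℝ} (h : x ≤ 0) : relu x = 0 := max_eq_left h
lemma relu_nonneg (x : ℝ) : 0 ≤ relu x := le_max_left _ _
lemma relu_add_neg (x : ℝ) : relu x + relu (-x) = |x| := by
  rcases le_total 0 x with h | h
  · rw [relu_of_nonneg h, relu_of_nonpos (by linarith), abs_of_nonneg h]; ring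
  · rw [relu_of_nonpos h, relu_of_nonneg (by linarith), abs_of_nonpos h]; ring
lemma relu_sub_neg (x : ℝ) : relu x - relu (-x) = x := by
  rcases le_total 0 x with h | h
  · rw [relu_of_nonneg h, relu_of_nonpos (by linarith)]; ring
  · rw [relu_of_nonpos h, relu_of_nonneg (by linarith)]; ring

def ramp (k : ℕ) (w : ℝ) : ℝ := relu (w - k) - relu (w - (k + 1))

lemma ramp_mono (k : ℕ) : Monotone (ramp k) := by
  intro x y h
  unfold ramp relu
  rcases max_cases 0 (x - k) with h1 | h1 <;> rcases max_cases 0 (y - k) with h2 | h2 <;>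
  rcases max_cases 0 (x - (k+1)) with h3 | h3 <;> rcases max_cases 0 (y - (k+1)) with h4 | h4 <;>
  linarith

lemma ramp_low {k : ℕ} {w : ℝ} (h : w ≤ k) : ramp k w = 0 := by
  unfold ramp; rw [relu_of_nonpos (by linarith), relu_of_nonpos (by linarith)]; ring
lemma ramp_high {k : ℕ} {w : ℝ} (h : (k:ℝ) + 1 ≤ w) : ramp k w = 1 := by
  unfold ramp; rw [relu_of_nonneg (by linarith), relu_of_nonneg (by linarith)]; ring
lemma ramp_mid {k : ℕ} {w : ℝ} (h : (k:ℝ) ≤ w) (h' : w ≤ k + 1) : ramp k w = w - k := by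
  unfold ramp; rw [relu_of_nonneg (by linarith), relu_of_nonpos (by linarith)]; ring

lemma sum_ramp (n : ℕ) (w : ℝ) : ∑ k ∈ Finset.range n, ramp k w = relu w - relu (w - n) := by
  induction n with
  | zero => simp
  | succ n ih => rw [Finset.sum_range_succ, ih]; unfold ramp; push_cast; ring

lemma ramp_lip (n : ℕ) (c : ℕ → ℝ) (C : ℝ) (hC : ∀ k < n, |c k| ≤ C) (hC0 : 0 ≤ C) (x y : ℝ) :
    |∑ k ∈ Finset.range n, c k * ramp k x - ∑ k ∈ Finset.range n, c k * ramp k y|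
      ≤ C * |x - y| := by
  wlog h : y ≤ x generalizing x y
  · rw [abs_sub_comm, abs_sub_comm x y]; exact this y x (le_of_not_ge h)
  rw [← Finset.sum_sub_distrib]
  calc |∑ k ∈ Finset.range n, (c k * ramp k x - c k * ramp k y)|
      ≤ ∑ k ∈ Finset.range n, |c k * ramp k x - c k * ramp k y| := Finset.abs_sum_le_sum_abs _ _
    _ ≤ ∑ k ∈ Finset.range n, C * (ramp k x - ramp k y) := by
        apply Finset.sum_le_sum
        intro k hk
        have h1 := ramp_mono k h
        rw [← mul_sub, abs_mul, abs_of_nonneg (sub_nonneg.2 h1)]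
        exact mul_le_mul_of_nonneg_right (hC k (Finset.mem_range.1 hk)) (sub_nonneg.2 h1)
    _ = C * ((relu x - relu (x - n)) - (relu y - relu (y - n))) := by
        rw [← Finset.mul_sum, Finset.sum_sub_distrib, sum_ramp, sum_ramp]
    _ ≤ C * |x - y| := by
        apply mul_le_mul_of_nonneg_left _ hC0
        rw [abs_of_nonneg (sub_nonneg.2 h)]
        have h2 : relu (y - n) ≤ relu (x - n) := relu_mono (by linarith)
        have h3 : relu x - relu y ≤ x - y := by
          unfold relu
          rcases max_cases 0 x with h1 | h1 <;> rcases max_cases 0 y with h2 | h2 <;> linarith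
        linarith

def tt (n : ℕ) (w : ℝ) : ℝ := ∑ k ∈ Finset.range n, (-1 : ℝ)^k * ramp k w
def rr (n : ℕ) (w : ℝ) : ℝ := ∑ k ∈ Finset.range n, (-1 - 2 * (k:ℝ)) * ramp k w

lemma rr_high (n : ℕ) (w : ℝ) (h : (n:ℝ) ≤ w) : rr n w = -(n:ℝ)^2 := by
  induction n with
  | zero => simp [rr]
  | succ n ih =>
    push_cast at h
    have := ih (by linarith)
    unfold rr at this ⊢
    rw [Finset.sum_range_succ, this, ramp_high h]; push_cast; ring

lemma tt_high (n : ℕ) (w : ℝ) (h : (n:ℝ) ≤ w) : tt n w = (1 - (-1:ℝ)^n) / 2 := by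
  induction n with
  | zero => simp [tt]
  | succ n ih =>
    push_cast at h
    have := ih (by linarith)
    unfold tt at this ⊢
    rw [Finset.sum_range_succ, this, ramp_high h, pow_succ]; ring

lemma key (n : ℕ) (w : ℝ) (h0 : 0 ≤ w) (h : w ≤ n) :
    -rr n w - w^2 = tt n w - (tt n w)^2 ∧ 0 ≤ tt n w ∧ tt n w ≤ 1 := by
  induction n with
  | zero =>
    have : w = 0 := le_antisymm (by simpa using h) h0
    simp [this, rr, tt]
  | succ n ih =>
    rcases le_total w n with hw | hw
    · have := ih hw
      have e1 : rr (n+1) w = rr n w := by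
        unfold rr; rw [Finset.sum_range_succ, ramp_low hw]; ring
      have e2 : tt (n+1) w = tt n w := by
        unfold tt; rw [Finset.sum_range_succ, ramp_low hw]; ring
      rw [e1, e2]; exact this
    · push_cast at h
      have e1 : rr (n+1) w = -(n:ℝ)^2 + (-1 - 2 * (n:ℝ)) * (w - n) := by
        rw [← rr_high n w hw, ← ramp_mid hw h]; unfold rr; rw [Finset.sum_range_succ]
      have e2 : tt (n+1) w = (1 - (-1:ℝ)^n) / 2 + (-1:ℝ)^n * (w - n) := by
        rw [← tt_high n w hw, ← ramp_mid hw h]; unfold tt; rw [Finset.sum_range_succ]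
      rw [e1, e2]
      rcases neg_one_pow_eq_or ℝ n with h1 | h1 <;> rw [h1] <;>
        exact ⟨by ring, by linarith, by linarith⟩

def T (M : ℕ) (z : ℝ) : ℝ := tt M (M * z)
def R (M : ℕ) (z : ℝ) : ℝ :=
  ((M:ℝ)^2)⁻¹ * ∑ k ∈ Finset.range M, ((M:ℝ) + (-1 - 2 * (k:ℝ))) * ramp k (M * z)
def S (M m : ℕ) (z : ℝ) : ℝ := ∑ i ∈ Finset.range m, (((M:ℝ)^2)⁻¹)^i * R M ((T M)^[i] z)
def q (z : ℝ) : ℝ := z - z^2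

lemma R_key (M : ℕ) (hM : 2 ≤ M) (z : ℝ) (h0 : 0 ≤ z) (h1 : z ≤ 1) :
    q z = R M z + ((M:ℝ)^2)⁻¹ * q (T M z) := by
  have hM' : (0:ℝ) < M := by positivity
  have hz : 0 ≤ M * z := by positivity
  have hz1 : M * z ≤ M := by nlinarith
  have := (key M (M*z) hz hz1).1
  have hR : ∑ k ∈ Finset.range M, ((M:ℝ) + (-1 - 2 * (k:ℝ))) * ramp k (M * z)
      = M * (M * z) + rr M (M * z) := by
    rw [Finset.sum_congr rfl (fun (k:ℕ) _ => add_mul (M:ℝ) (-1 - 2 * (k:ℝ)) (ramp k (M * z))),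
      Finset.sum_add_distrib, ← Finset.mul_sum, sum_ramp, relu_of_nonneg hz,
      relu_of_nonpos (by linarith)]
    unfold rr
    ring
  unfold R q T
  rw [hR, ← this]
  field_simp
  ring

lemma T_mem (M : ℕ) (z : ℝ) (h0 : 0 ≤ z) (h1 : z ≤ 1) : 0 ≤ T M z ∧ T M z ≤ 1 := by
  have hM' : (0:ℝ) ≤ M := by positivity
  exact (key M (M*z) (by positivity) (by nlinarith)).2

lemma T_iter_mem (M i : ℕ) (z : ℝ) (h0 : 0 ≤ z) (h1 : z ≤ 1) :
    0 ≤ (T M)^[i] z ∧ (T M)^[i] z ≤ 1 := by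
  induction i with
  | zero => exact ⟨h0, h1⟩
  | succ i ih => rw [Function.iterate_succ_apply']; exact T_mem M _ ih.1 ih.2

lemma T_end (M : ℕ) (z : ℝ) (h : z = 0 ∨ z = 1) : T M z = 0 ∨ T M z = 1 := by
  rcases h with rfl | rfl
  · left
    unfold T tt
    apply Finset.sum_eq_zero
    intro k _
    rw [ramp_low (by simp)]; ring
  · unfold T
    rw [tt_high M _ (by simp)]
    rcases neg_one_pow_eq_or ℝ M with h1 | h1 <;> rw [h1] <;> norm_num

lemma T_iter_end (M i : ℕ) (z : ℝ) (h : z = 0 ∨ z = 1) :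
    (T M)^[i] z = 0 ∨ (T M)^[i] z = 1 := by
  induction i with
  | zero => exact h
  | succ i ih => rw [Function.iterate_succ_apply']; exact T_end M _ ih

lemma S_key (M : ℕ) (hM : 2 ≤ M) (m : ℕ) (z : ℝ) (h0 : 0 ≤ z) (h1 : z ≤ 1) :
    q z = S M m z + (((M:ℝ)^2)⁻¹)^m * q ((T M)^[m] z) := by
  induction m with
  | zero => simp [S]
  | succ m ih =>
    obtain ⟨a, b⟩ := T_iter_mem M m z h0 h1
    rw [ih, R_key M hM _ a b, Function.iterate_succ_apply']
    unfold S
    rw [Finset.sum_range_succ, pow_succ]; ring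

lemma S_end (M : ℕ) (hM : 2 ≤ M) (m : ℕ) (z : ℝ) (h : z = 0 ∨ z = 1) : S M m z = 0 := by
  have h1 := S_key M hM m z (by rcases h with rfl | rfl <;> norm_num)
    (by rcases h with rfl | rfl <;> norm_num)
  have e : ∀ y : ℝ, (y = 0 ∨ y = 1) → q y = 0 := by
    rintro y (rfl | rfl) <;> norm_num [q]
  rw [e _ h, e _ (T_iter_end M m z h)] at h1
  linarith

lemma T_lip (M : ℕ) (x y : ℝ) : |T M x - T M y| ≤ M * |x - y| := by
  have := ramp_lip M (fun k => (-1:ℝ)^k) 1 (by intro k _; simp) (by norm_num) (M*x) (M*y)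
  rw [← mul_sub, abs_mul, Nat.abs_cast, one_mul] at this
  exact this

lemma T_iter_lip (M i : ℕ) (x y : ℝ) :
    |(T M)^[i] x - (T M)^[i] y| ≤ (M:ℝ)^i * |x - y| := by
  induction i with
  | zero => simp
  | succ i ih =>
    rw [Function.iterate_succ_apply', Function.iterate_succ_apply']
    refine (T_lip M _ _).trans ?_
    rw [pow_succ', mul_assoc]
    exact mul_le_mul_of_nonneg_left ih (by positivity)

lemma R_lip (M : ℕ) (hM : 2 ≤ M) (x y : ℝ) : |R M x - R M y| ≤ (1 - (M:ℝ)⁻¹) * |x - y| := by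
  have hM2 : (2:ℝ) ≤ M := by exact_mod_cast hM
  have := ramp_lip M (fun k => (M:ℝ) + (-1 - 2 * (k:ℝ))) (M - 1) (by
    intro k hk
    have : (k:ℝ) + 1 ≤ M := by exact_mod_cast hk
    have hk0 : (0:ℝ) ≤ k := by positivity
    rw [abs_le]; constructor <;> linarith) (by linarith) (M*x) (M*y)
  rw [← mul_sub (M:ℝ), abs_mul, Nat.abs_cast] at this
  unfold R
  rw [← mul_sub, abs_mul, abs_of_nonneg (by positivity)]
  calc _ ≤ ((M:ℝ)^2)⁻¹ * ((M - 1) * (M * |x - y|)) := mul_le_mul_of_nonneg_left this (by positivity)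
    _ = _ := by field_simp

lemma S_lip (M : ℕ) (hM : 2 ≤ M) (m : ℕ) (x y : ℝ) :
    |S M m x - S M m y| ≤ (1 - ((M:ℝ)⁻¹)^m) * |x - y| := by
  have hM2 : (2:ℝ) ≤ M := by exact_mod_cast hM
  have hi : (M:ℝ)⁻¹ ≤ 1 := inv_le_one_of_one_le₀ (by linarith)
  induction m with
  | zero => simp [S]
  | succ m ih =>
    have e : S M (m+1) x - S M (m+1) y = (S M m x - S M m y) +
        (((M:ℝ)^2)⁻¹)^m * (R M ((T M)^[m] x) - R M ((T M)^[m] y)) := by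
      unfold S; rw [Finset.sum_range_succ, Finset.sum_range_succ]; ring
    rw [e]
    refine (abs_add_le _ _).trans ?_
    rw [abs_mul, abs_of_nonneg (a := (((M:ℝ)^2)⁻¹)^m) (by positivity)]
    have h1 : |R M ((T M)^[m] x) - R M ((T M)^[m] y)| ≤ (1 - (M:ℝ)⁻¹) * ((M:ℝ)^m * |x - y|) :=
      (R_lip M hM _ _).trans (mul_le_mul_of_nonneg_left (T_iter_lip M m x y) (by linarith))
    have h2 := mul_le_mul_of_nonneg_left h1 (show 0 ≤ (((M:ℝ)^2)⁻¹)^m by positivity)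
    have h3 : (((M:ℝ)^2)⁻¹)^m * ((1 - (M:ℝ)⁻¹) * ((M:ℝ)^m * |x - y|))
        = (1 - (M:ℝ)⁻¹) * ((M:ℝ)⁻¹)^m * |x - y| := by
      have : (((M:ℝ)^2)⁻¹)^m * (M:ℝ)^m = ((M:ℝ)⁻¹)^m := by
        rw [← mul_pow]; congr 1; field_simp
      rw [← this]; ring
    rw [h3] at h2
    rw [pow_succ ((M:ℝ)⁻¹) m]
    linarith

lemma E_lip (M : ℕ) (hM : 2 ≤ M) (m : ℕ) (x y : ℝ) (hx : 0 ≤ x) (hx1 : x ≤ 1)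
    (hy : 0 ≤ y) (hy1 : y ≤ 1) :
    |(q x - S M m x) - (q y - S M m y)| ≤ ((M:ℝ)⁻¹)^m * |x - y| := by
  have hM2 : (2:ℝ) ≤ M := by exact_mod_cast hM
  rw [S_key M hM m x hx hx1, S_key M hM m y hy hy1]
  obtain ⟨a0, a1⟩ := T_iter_mem M m x hx hx1
  obtain ⟨b0, b1⟩ := T_iter_mem M m y hy hy1
  have hl := T_iter_lip M m x y
  set a := (T M)^[m] x
  set b := (T M)^[m] y
  have hq : |q a - q b| ≤ |a - b| := by
    have : q a - q b = (1 - (a + b)) * (a - b) := by unfold q; ring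
    rw [this, abs_mul]
    have : |1 - (a + b)| ≤ 1 := by rw [abs_le]; constructor <;> linarith
    nlinarith [abs_nonneg (a - b)]
  have e : (S M m x + (((M:ℝ)^2)⁻¹)^m * q a - S M m x) - (S M m y + (((M:ℝ)^2)⁻¹)^m * q b - S M m y)
    = (((M:ℝ)^2)⁻¹)^m * (q a - q b) := by ring
  rw [e, abs_mul, abs_of_nonneg (by positivity)]
  have : (((M:ℝ)^2)⁻¹)^m * (M:ℝ)^m = ((M:ℝ)⁻¹)^m := by
    rw [← mul_pow]; congr 1; field_simp
  rw [← this, mul_assoc]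
  exact mul_le_mul_of_nonneg_left (hq.trans hl) (by positivity)

def prod2 (M m : ℕ) (P x : ℝ) : ℝ :=
  (|P + x| / 2 - |P - x| / 2) - (S M m (|P + x| / 2) - S M m (|P - x| / 2))

lemma prod2_comm (M m : ℕ) (P x : ℝ) : prod2 M m P x = prod2 M m x P := by
  unfold prod2; rw [add_comm P x, abs_sub_comm P x]

lemma prod2_zero (M m : ℕ) (P : ℝ) : prod2 M m P 0 = 0 := by simp [prod2]
lemma prod2_zero' (M m : ℕ) (P : ℝ) : prod2 M m 0 P = 0 := by rw [prod2_comm, prod2_zero]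

lemma ab_facts {P x : ℝ} (hP : 0 ≤ P ∧ P ≤ 1) (hx : 0 ≤ x ∧ x ≤ 1) :
    0 ≤ |P - x| / 2 ∧ |P - x| / 2 ≤ |P + x| / 2 ∧ |P + x| / 2 ≤ 1 ∧
    |P + x| / 2 - |P - x| / 2 ≤ 1 ∧ |P + x| = P + x := by
  obtain ⟨h1, h2⟩ := hP
  obtain ⟨h3, h4⟩ := hx
  rw [abs_of_nonneg (by linarith : 0 ≤ P + x)]
  rcases abs_cases (P - x) with h | h <;> refine ⟨?_, ?_, ?_, ?_, rfl⟩ <;> linarith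

lemma prod2_mem {M : ℕ} (hM : 2 ≤ M) (m : ℕ) {P x : ℝ}
    (hP : 0 ≤ P ∧ P ≤ 1) (hx : 0 ≤ x ∧ x ≤ 1) : 0 ≤ prod2 M m P x ∧ prod2 M m P x ≤ 1 := by
  have hM2 : (2:ℝ) ≤ M := by exact_mod_cast hM
  obtain ⟨h1, h2, h3, -, -⟩ := ab_facts hP hx
  unfold prod2
  set a := |P + x| / 2
  set b := |P - x| / 2
  have mono : ∀ u v : ℝ, u ≤ v → S M m v - S M m u ≤ v - u ∧ - (v - u) ≤ S M m v - S M m u := by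
    intro u v huv
    have h := S_lip M hM m v u
    rw [abs_of_nonneg (sub_nonneg.2 huv)] at h
    have hp : (0:ℝ) ≤ ((M:ℝ)⁻¹)^m := by positivity
    have h' : |S M m v - S M m u| ≤ v - u := by nlinarith
    exact ⟨(le_abs_self _).trans h', (abs_le.1 h').1⟩
  have s0 := S_end M hM m 0 (Or.inl rfl)
  have s1 := S_end M hM m 1 (Or.inr rfl)
  have m1 := mono b a h2
  have m2 := mono a 1 h3
  have m3 := mono 0 b h1
  constructor <;> linarith

lemma prod2_err {M : ℕ} (hM : 2 ≤ M) (m : ℕ) {P x : ℝ}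
    (hP : 0 ≤ P ∧ P ≤ 1) (hx : 0 ≤ x ∧ x ≤ 1) : |prod2 M m P x - P * x| ≤ ((M:ℝ)⁻¹)^m := by
  obtain ⟨h1, h2, h3, h4, h5⟩ := ab_facts hP hx
  have hE := E_lip M hM m _ _ (h1.trans h2) h3 h1 (h2.trans h3)
  have e : prod2 M m P x - P * x = (q (|P + x| / 2) - S M m (|P + x| / 2)) -
      (q (|P - x| / 2) - S M m (|P - x| / 2)) := by
    unfold prod2 q
    rw [div_pow, div_pow, sq_abs, sq_abs]; ring
  rw [e]
  refine hE.trans ?_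
  rw [abs_of_nonneg (sub_nonneg.2 h2)]
  exact mul_le_of_le_one_right (by positivity) h4

lemma prod2_err_lip {M : ℕ} (hM : 2 ≤ M) (m : ℕ) {P x : ℝ}
    (hP : 0 ≤ P ∧ P ≤ 1) (hx : 0 ≤ x ∧ x ≤ 1) {P' : ℝ} (hP' : 0 ≤ P' ∧ P' ≤ 1) :
    |(prod2 M m P x - P * x) - (prod2 M m P' x - P' * x)| ≤ ((M:ℝ)⁻¹)^m * |P - P'| := by
  obtain ⟨h1, h2, h3, h4, h5⟩ := ab_facts hP hx
  obtain ⟨h1', h2', h3', h4', h5'⟩ := ab_facts hP' hx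
  have hE := E_lip M hM m _ _ (h1.trans h2) h3 (h1'.trans h2') h3'
  have hE' := E_lip M hM m _ _ h1 (h2.trans h3) h1' (h2'.trans h3')
  have e : ∀ P, prod2 M m P x - P * x = (q (|P + x| / 2) - S M m (|P + x| / 2)) -
      (q (|P - x| / 2) - S M m (|P - x| / 2)) := by
    intro P
    unfold prod2 q
    rw [div_pow, div_pow, sq_abs, sq_abs]; ring
  rw [e, e, sub_sub_sub_comm]
  refine (abs_sub _ _).trans ((add_le_add hE hE').trans ?_)
  rw [← mul_add]
  apply mul_le_mul_of_nonneg_left _ (by positivity)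
  have k1 : |(|P + x| / 2 - |P' + x| / 2)| ≤ |P - P'| / 2 := by
    rw [← sub_div, abs_div, abs_of_pos (by norm_num : (0:ℝ) < 2)]
    have := abs_abs_sub_abs_le (P + x) (P' + x)
    rw [add_sub_add_right_eq_sub] at this
    linarith
  have k2 : |(|P - x| / 2 - |P' - x| / 2)| ≤ |P - P'| / 2 := by
    rw [← sub_div, abs_div, abs_of_pos (by norm_num : (0:ℝ) < 2)]
    have := abs_abs_sub_abs_le (P - x) (P' - x)
    rw [sub_sub_sub_cancel_right] at this
    linarith
  linarith

end MPN
namespace MPN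

def Pn (M m : ℕ) (y : ℕ → ℝ) : ℕ → ℝ
  | 0 => y 0
  | i+1 => prod2 M m (Pn M m y i) (relu (y (i+1)))

def Pi' (y : ℕ → ℝ) (i : ℕ) : ℝ := ∏ j ∈ Finset.range (i+1), y j

lemma Pi'_succ (y : ℕ → ℝ) (i : ℕ) : Pi' y (i+1) = Pi' y i * y (i+1) := by
  unfold Pi'; rw [Finset.prod_range_succ]

lemma Pi'_mem {y : ℕ → ℝ} (hy : ∀ i, 0 ≤ y i ∧ y i ≤ 1) (i : ℕ) : 0 ≤ Pi' y i ∧ Pi' y i ≤ 1 :=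
  ⟨Finset.prod_nonneg fun j _ => (hy j).1, Finset.prod_le_one (fun j _ => (hy j).1) fun j _ => (hy j).2⟩

lemma Pn_mem {M : ℕ} (hM : 2 ≤ M) (m : ℕ) {y : ℕ → ℝ} (hy : ∀ i, 0 ≤ y i ∧ y i ≤ 1) (i : ℕ) :
    0 ≤ Pn M m y i ∧ Pn M m y i ≤ 1 := by
  induction i with
  | zero => exact hy 0
  | succ i ih =>
    unfold Pn
    rw [relu_of_nonneg (hy _).1]
    exact prod2_mem hM m ih (hy _)

lemma Pn_zero (M m : ℕ) (y : ℕ → ℝ) (j i : ℕ) (hj : y j = 0) (hji : j ≤ i) : Pn M m y i = 0 := by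
  induction i with
  | zero =>
    obtain rfl : j = 0 := by omega
    exact hj
  | succ i ih =>
    unfold Pn
    rcases Nat.lt_or_ge i j with h | h
    · obtain rfl : j = i + 1 := by omega
      rw [hj, relu_of_nonneg le_rfl, prod2_zero]
    · rw [ih h, prod2_zero']

lemma Pn_err {M : ℕ} (hM : 2 ≤ M) (m : ℕ) {y : ℕ → ℝ} (hy : ∀ i, 0 ≤ y i ∧ y i ≤ 1) (i : ℕ) :
    |Pn M m y i - Pi' y i| ≤ i * ((M:ℝ)⁻¹)^m := by
  induction i with
  | zero => simp [Pn, Pi']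
  | succ i ih =>
    rw [Pi'_succ]
    unfold Pn
    rw [relu_of_nonneg (hy _).1]
    have h1 := prod2_err hM m (Pn_mem hM m hy i) (hy (i+1))
    have e : prod2 M m (Pn M m y i) (y (i+1)) - Pi' y i * y (i+1) =
      (prod2 M m (Pn M m y i) (y (i+1)) - Pn M m y i * y (i+1)) +
        (Pn M m y i - Pi' y i) * y (i+1) := by ring
    rw [e]
    have h2 : |(Pn M m y i - Pi' y i) * y (i+1)| ≤ i * ((M:ℝ)⁻¹)^m := by
      rw [abs_mul, abs_of_nonneg (hy _).1]
      exact (mul_le_of_le_one_right (abs_nonneg _) (hy _).2).trans ih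
    refine (abs_add_le _ _).trans ?_
    push_cast
    linarith

def dist1 (y y' : ℕ → ℝ) (i : ℕ) : ℝ := ∑ j ∈ Finset.range (i+1), |y j - y' j|

lemma dist1_nonneg (y y' : ℕ → ℝ) (i : ℕ) : 0 ≤ dist1 y y' i :=
  Finset.sum_nonneg fun _ _ => abs_nonneg _

lemma dist1_succ (y y' : ℕ → ℝ) (i : ℕ) :
    dist1 y y' (i+1) = dist1 y y' i + |y (i+1) - y' (i+1)| := by
  unfold dist1; rw [Finset.sum_range_succ]

lemma Pi'_lip {y y' : ℕ → ℝ} (hy : ∀ i, 0 ≤ y i ∧ y i ≤ 1)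
    (hy' : ∀ i, 0 ≤ y' i ∧ y' i ≤ 1) (i : ℕ) :
    |Pi' y i - Pi' y' i| ≤ dist1 y y' i := by
  induction i with
  | zero => simp [Pi', dist1]
  | succ i ih =>
    rw [Pi'_succ, Pi'_succ, dist1_succ]
    have e : Pi' y i * y (i+1) - Pi' y' i * y' (i+1) =
      (Pi' y i - Pi' y' i) * y (i+1) + Pi' y' i * (y (i+1) - y' (i+1)) := by ring
    rw [e]
    refine (abs_add_le _ _).trans ?_
    rw [abs_mul, abs_mul, abs_of_nonneg (hy _).1, abs_of_nonneg (Pi'_mem hy' i).1]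
    have h1 := mul_le_of_le_one_right (abs_nonneg (Pi' y i - Pi' y' i)) (hy (i+1)).2
    have h2 := mul_le_of_le_one_left (abs_nonneg (y (i+1) - y' (i+1))) (Pi'_mem hy' i).2
    linarith

lemma Pn_err_lip {M : ℕ} (hM : 2 ≤ M) (m : ℕ) {y y' : ℕ → ℝ} (hy : ∀ i, 0 ≤ y i ∧ y i ≤ 1)
    (hy' : ∀ i, 0 ≤ y' i ∧ y' i ≤ 1) (i : ℕ) :
    |(Pn M m y i - Pi' y i) - (Pn M m y' i - Pi' y' i)| ≤
      ((1 + ((M:ℝ)⁻¹)^m)^i - 1) * dist1 y y' i := by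
  have hh : (0:ℝ) ≤ ((M:ℝ)⁻¹)^m := by positivity
  induction i with
  | zero => simp [Pn, Pi']
  | succ i ih =>
    have hP := Pn_mem hM m hy i
    have hP' := Pn_mem hM m hy' i
    have hg' := Pn_err hM m hy' i
    have hPi := Pi'_lip hy hy' i
    have hd := dist1_nonneg y y' i
    have hB := one_add_mul_le_pow (a := ((M:ℝ)⁻¹)^m) (by linarith) i
    rw [Pi'_succ, Pi'_succ, dist1_succ]
    unfold Pn
    rw [relu_of_nonneg (hy _).1, relu_of_nonneg (hy' _).1]
    have hx := hy (i+1)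
    have hx' := hy' (i+1)
    have l1 := prod2_err_lip hM m hP hx hP'
    have l2 := prod2_err_lip hM m hx hP' hx'
    rw [prod2_comm, prod2_comm M m (y' (i+1))] at l2
    set h := ((M:ℝ)⁻¹)^m
    set P := Pn M m y i
    set P' := Pn M m y' i
    set Q := Pi' y i
    set Q' := Pi' y' i
    set x := y (i+1)
    set x' := y' (i+1)
    set D := dist1 y y' i
    set G := (1 + h)^i
    have hPP : |P - P'| ≤ G * D := by
      have e : P - P' = ((P - Q) - (P' - Q')) + (Q - Q') := by ring
      rw [e]
      refine (abs_add_le _ _).trans ?_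
      linarith
    have e : (prod2 M m P x - Q * x) - (prod2 M m P' x' - Q' * x') =
      ((prod2 M m P x - P * x) - (prod2 M m P' x - P' * x)) +
      ((prod2 M m P' x - x * P') - (prod2 M m P' x' - x' * P')) +
      (((P - Q) - (P' - Q')) * x + (P' - Q') * (x - x')) := by ring
    rw [e]
    have a1 : |((P - Q) - (P' - Q')) * x| ≤ (G - 1) * D := by
      rw [abs_mul, abs_of_nonneg hx.1]
      exact (mul_le_of_le_one_right (abs_nonneg _) hx.2).trans ih
    have a2 : |(P' - Q') * (x - x')| ≤ (i * h) * |x - x'| := by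
      rw [abs_mul]; exact mul_le_mul_of_nonneg_right hg' (abs_nonneg _)
    have a3 : h * |P - P'| ≤ h * (G * D) := mul_le_mul_of_nonneg_left hPP hh
    have a4 : (h + i * h) * |x - x'| ≤ ((1+h)^(i+1) - 1) * |x - x'| := by
      apply mul_le_mul_of_nonneg_right _ (abs_nonneg _)
      have := one_add_mul_le_pow (a := h) (by linarith) (i+1)
      push_cast at this
      linarith
    refine (abs_add_le _ _).trans ((add_le_add (abs_add_le _ _) (abs_add_le _ _)).trans ?_)
    have e2 : (1+h)^(i+1) = G + h * G := by rw [pow_succ]; ring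
    rw [e2] at a4 ⊢
    linarith

end MPN
namespace MPN

def Aff {X κ : Type} [Fintype κ] (F : X → κ → ℝ) (g : X → ℝ) : Prop :=
  ∃ (w : κ → ℝ) (b : ℝ), ∀ x, g x = ∑ l, w l * F x l + b

section
variable {X κ : Type} [Fintype κ] {F : X → κ → ℝ}

lemma Aff.const (c : ℝ) : Aff F (fun _ => c) := ⟨0, c, by simp⟩

lemma Aff.coord (l : κ) : Aff F (fun x => F x l) := by
  classical
  exact ⟨Pi.single l 1, 0, by intro x; simp [Pi.single_apply]⟩

lemma Aff.add {g h : X → ℝ} (hg : Aff F g) (hh : Aff F h) : Aff F (fun x => g x + h x) := by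
  obtain ⟨w, b, e⟩ := hg
  obtain ⟨w', b', e'⟩ := hh
  refine ⟨w + w', b + b', fun x => ?_⟩
  simp only [e, e', Pi.add_apply, add_mul, Finset.sum_add_distrib]; ring

lemma Aff.smul {g : X → ℝ} (c : ℝ) (hg : Aff F g) : Aff F (fun x => c * g x) := by
  obtain ⟨w, b, e⟩ := hg
  refine ⟨fun l => c * w l, c * b, fun x => ?_⟩
  simp only [e, mul_assoc, mul_add, Finset.mul_sum]

lemma Aff.congr {g h : X → ℝ} (hg : Aff F g) (e : ∀ x, h x = g x) : Aff F h := by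
  have : h = g := funext e
  rwa [this]

lemma Aff.sub {g h : X → ℝ} (hg : Aff F g) (hh : Aff F h) : Aff F (fun x => g x - h x) :=
  (hg.add (hh.smul (-1))).congr fun x => by ring

lemma Aff.neg {g : X → ℝ} (hg : Aff F g) : Aff F (fun x => - g x) :=
  (hg.smul (-1)).congr fun x => by ring

lemma Aff.sum {g : ℕ → X → ℝ} (n : ℕ) (hg : ∀ k < n, Aff F (g k)) :
    Aff F (fun x => ∑ k ∈ Finset.range n, g k x) := by
  induction n with
  | zero => simpa using Aff.const 0
  | succ n ih =>
    simp only [Finset.sum_range_succ]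
    exact (ih fun k hk => hg k (by omega)).add (hg n (by omega))
end

inductive RNet (d : ℕ) (κ : Type) [Fintype κ] : ℕ → ((Fin d → ℝ) → κ → ℝ) → Prop
  | first (G : κ → (Fin d → ℝ) → ℝ) (h : ∀ i, Aff (fun x : Fin d → ℝ => x) (G i)) :
      RNet d κ 1 (fun x i => relu (G i x))
  | step (D : ℕ) (F : (Fin d → ℝ) → κ → ℝ) (hF : RNet d κ D F)
      (G : κ → (Fin d → ℝ) → ℝ) (h : ∀ i, Aff F (G i)) :
      RNet d κ (D+1) (fun x i => relu (G i x))

/-- ℕ-indexed forward pass -/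
def fw (d K : ℕ) (w : ℕ → ℕ → ℕ → ℝ) (b : ℕ → ℕ → ℝ) (x : ℕ → ℝ) : ℕ → ℕ → ℝ
  | 0, j => x j
  | k+1, j => (∑ l ∈ Finset.range (if k = 0 then d else K), w k j l *
      (if k = 0 then fw d K w b x k l else relu (fw d K w b x k l))) + b k j

lemma fw_congr (d K : ℕ) (w w' : ℕ → ℕ → ℕ → ℝ) (b b' : ℕ → ℕ → ℝ) (x : ℕ → ℝ) (D : ℕ)
    (hw : ∀ k < D, w k = w' k) (hb : ∀ k < D, b k = b' k) :
    fw d K w b x D = fw d K w' b' x D := by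
  induction D with
  | zero => rfl
  | succ D ih =>
    have := ih (fun k hk => hw k (by omega)) (fun k hk => hb k (by omega))
    funext j
    simp only [fw, this, hw D (by omega), hb D (by omega)]

def ext0 {d : ℕ} (x : Fin d → ℝ) (j : ℕ) : ℝ := if h : j < d then x ⟨j, h⟩ else 0

lemma ext0_val {d : ℕ} (x : Fin d → ℝ) (j : Fin d) : ext0 x j = x j := by simp [ext0]

def extW {K : ℕ} {κ : Type} (e : κ ≃ Fin K) (f : κ → ℝ) (j : ℕ) : ℝ :=
  if h : j < K then f (e.symm ⟨j, h⟩) else 0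

lemma extW_val {K : ℕ} {κ : Type} (e : κ ≃ Fin K) (f : κ → ℝ) (j : κ) :
    extW e f (e j) = f j := by simp [extW]

lemma sum_ext {K : ℕ} {κ : Type} [Fintype κ] (e : κ ≃ Fin K) (f : κ → ℝ) (g : ℕ → ℝ) :
    ∑ l ∈ Finset.range K, extW e f l * g l = ∑ l, f l * g (e l) := by
  rw [← Fin.sum_univ_eq_sum_range (fun l => extW e f l * g l) K, ← e.sum_comp]
  simp only [extW_val]

lemma RNet.fw {d K : ℕ} {κ : Type} [Fintype κ] (e : κ ≃ Fin K) {D : ℕ}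
    {F : (Fin d → ℝ) → κ → ℝ} (h : RNet d κ D F) :
    1 ≤ D ∧ ∃ w b, ∀ x l, F x l = relu (MPN.fw d K w b (ext0 x) D (e l)) := by
  induction h with
  | first G h =>
    refine ⟨le_rfl, ?_⟩
    choose w b hwb using h
    refine ⟨fun _ j l => extW e (fun i => ext0 (w i) l) j, fun _ j => extW e b j, fun x l => ?_⟩
    simp only [MPN.fw, if_true, extW_val, hwb]
    rw [← Fin.sum_univ_eq_sum_range (fun i => ext0 (w l) i * ext0 x i) d]
    simp only [ext0_val]
  | step D F hF G h ih =>
    refine ⟨by omega, ?_⟩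
    obtain ⟨hD, w0, b0, h0⟩ := ih
    choose w b hwb using h
    refine ⟨Function.update w0 D (fun j l => extW e (fun i => extW e (w i) l) j),
      Function.update b0 D (fun j => extW e b j), fun x l => ?_⟩
    have hc := fw_congr d K w0
      (Function.update w0 D (fun j l => extW e (fun i => extW e (w i) l) j)) b0
      (Function.update b0 D (fun j => extW e b j)) (ext0 x) D
      (fun k hk => by rw [Function.update_of_ne (by omega)])
      (fun k hk => by rw [Function.update_of_ne (by omega)])
    have hD0 : D ≠ 0 := by omega
    simp only [MPN.fw, hD0, if_false, ← hc, Function.update_self, extW_val]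
    rw [sum_ext e (w l) (fun i => relu (MPN.fw d K w0 b0 (ext0 x) D i))]
    simp only [hwb, h0]

lemma RNet.isNet {d N : ℕ} {κ : Type} [Fintype κ] {D : ℕ}
    {F : (Fin d → ℝ) → κ → ℝ} (h : RNet d κ D F) (hN : Fintype.card κ ≤ N)
    {g : (Fin d → ℝ) → ℝ} (hg : Aff F g) : IsReLUNet d N D g := by
  let e := Fintype.equivFin κ
  set K := Fintype.card κ with hK
  obtain ⟨hD, w0, b0, h0⟩ := h.fw e
  obtain ⟨w, b, hwb⟩ := hg
  have hD0 : D ≠ 0 := by omega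
  set w1 := Function.update w0 D (fun _ l => extW e w l) with hw1
  set b1 := Function.update b0 D (fun _ => b) with hb1
  have hgf : ∀ x, g x = MPN.fw d K w1 b1 (ext0 x) (D+1) 0 := by
    intro x
    have hc := fw_congr d K w0 w1 b0 b1 (ext0 x) D
      (fun k hk => by rw [hw1, Function.update_of_ne (by omega)])
      (fun k hk => by rw [hb1, Function.update_of_ne (by omega)])
    simp only [MPN.fw, hD0, if_false, ← hc]
    simp only [hw1, hb1, Function.update_self]
    rw [sum_ext e w (fun i => relu (MPN.fw d K w0 b0 (ext0 x) D i)), hwb]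
    simp only [h0]
  let n : ℕ → ℕ := fun i => if i = 0 then d else if i ≤ D then K else 1
  have hn : ∀ k ≤ D, n k = if k = 0 then d else K := by
    intro k hk
    simp only [n, hk, if_true]
  have n0 : n 0 = d := by simp [n]
  refine ⟨n, n0, by simp [n], fun i j l => w1 i j l, fun i j => b1 i j, fun _ _ => relu, ?_, ?_⟩
  · intro i h1 h2
    refine ⟨?_, fun l => rfl⟩
    rw [hn i h2, if_neg (by omega)]
    exact hN
  · intro x
    have key : ∀ k ≤ D + 1, ∀ j : Fin (n k),
        nnForward n (fun i j l => w1 i j l) (fun i j => b1 i j) (fun _ _ => relu) k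
          (fun j => x (Fin.cast n0 j)) j = MPN.fw d K w1 b1 (ext0 x) k j := by
      intro k
      induction k with
      | zero =>
        intro _ j
        simp only [nnForward, MPN.fw]
        rw [← ext0_val x]; rfl
      | succ k ih =>
        intro hk j
        have ih := ih (by omega)
        simp only [nnForward, MPN.fw, ih]
        rw [← hn k (by omega), Fin.sum_univ_eq_sum_range (fun l => w1 k j l *
          (if k = 0 then MPN.fw d K w1 b1 (ext0 x) k l
            else relu (MPN.fw d K w1 b1 (ext0 x) k l))) (n k)]
    rw [hgf, key _ le_rfl]
    rfl

abbrev Idx (M s : ℕ) : Type := Fin 4 ⊕ (Fin (M+1) ⊕ Fin (M+1)) ⊕ Fin 2 ⊕ Fin s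

def pre (M s : ℕ) (q : Fin 4 → ℝ) (a b c : ℝ) (x : Fin s → ℝ) : Idx M s → ℝ
  | .inl i => q i
  | .inr (.inl (.inl j)) => M * a - (j:ℕ)
  | .inr (.inl (.inr j)) => M * b - (j:ℕ)
  | .inr (.inr (.inl k)) => if k = 0 then c else -c
  | .inr (.inr (.inr i)) => x i

def St (M s : ℕ) (q : Fin 4 → ℝ) (a b c : ℝ) (x : Fin s → ℝ) (l : Idx M s) : ℝ :=
  relu (pre M s q a b c x l)

lemma St_step (M s D : ℕ) (q q' : (Fin s → ℝ) → Fin 4 → ℝ) (a b c a' b' c' : (Fin s → ℝ) → ℝ)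
    (h : RNet s (Idx M s) D (fun x => St M s (q x) (a x) (b x) (c x) x))
    (hq : ∀ i, Aff (fun x => St M s (q x) (a x) (b x) (c x) x) (fun x => q' x i))
    (ha : Aff (fun x => St M s (q x) (a x) (b x) (c x) x) a')
    (hb : Aff (fun x => St M s (q x) (a x) (b x) (c x) x) b')
    (hc : Aff (fun x => St M s (q x) (a x) (b x) (c x) x) c') :
    RNet s (Idx M s) (D+1) (fun x => St M s (q' x) (a' x) (b' x) (c' x) x) := by
  have := RNet.step D _ h (fun l x => pre M s (q' x) (a' x) (b' x) (c' x) (fun i => relu (x i)) l)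
    (by
      rintro (i | ((j | j) | (k | i)))
      · exact hq i
      · exact (ha.smul M).sub (Aff.const _)
      · exact (hb.smul M).sub (Aff.const _)
      · simp only [pre]
        split_ifs
        · exact hc
        · exact hc.neg
      · exact Aff.coord (F := fun x => St M s (q x) (a x) (b x) (c x) x) (.inr (.inr (.inr i))))
  convert this using 1
  funext x l
  rcases l with (i | ((j | j) | (k | i))) <;> simp only [St, pre]
  rw [relu_of_nonneg (relu_nonneg _)]

section
variable {M s : ℕ} {q : (Fin s → ℝ) → Fin 4 → ℝ} {a b c : (Fin s → ℝ) → ℝ}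

lemma aff_x (i : Fin s) :
    Aff (fun x => St M s (q x) (a x) (b x) (c x) x) (fun x => relu (x i)) :=
  Aff.coord (F := fun x => St M s (q x) (a x) (b x) (c x) x) (.inr (.inr (.inr i)))

lemma aff_c : Aff (fun x => St M s (q x) (a x) (b x) (c x) x) c := by
  have h0 := Aff.coord (F := fun x => St M s (q x) (a x) (b x) (c x) x) (.inr (.inr (.inl 0)))
  have h1 := Aff.coord (F := fun x => St M s (q x) (a x) (b x) (c x) x) (.inr (.inr (.inl 1)))
  refine (h0.sub h1).congr fun x => ?_
  simp [St, pre, relu_sub_neg]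

lemma aff_ramp_a (k : ℕ) (hk : k < M) :
    Aff (fun x => St M s (q x) (a x) (b x) (c x) x) (fun x => ramp k (M * a x)) := by
  have h0 := Aff.coord (F := fun x => St M s (q x) (a x) (b x) (c x) x)
    (.inr (.inl (.inl ⟨k, by omega⟩)))
  have h1 := Aff.coord (F := fun x => St M s (q x) (a x) (b x) (c x) x)
    (.inr (.inl (.inl ⟨k+1, by omega⟩)))
  refine (h0.sub h1).congr fun x => ?_
  simp [St, pre, ramp]

lemma aff_ramp_b (k : ℕ) (hk : k < M) :
    Aff (fun x => St M s (q x) (a x) (b x) (c x) x) (fun x => ramp k (M * b x)) := by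
  have h0 := Aff.coord (F := fun x => St M s (q x) (a x) (b x) (c x) x)
    (.inr (.inl (.inr ⟨k, by omega⟩)))
  have h1 := Aff.coord (F := fun x => St M s (q x) (a x) (b x) (c x) x)
    (.inr (.inl (.inr ⟨k+1, by omega⟩)))
  refine (h0.sub h1).congr fun x => ?_
  simp [St, pre, ramp]

lemma aff_T_a : Aff (fun x => St M s (q x) (a x) (b x) (c x) x) (fun x => T M (a x)) :=
  Aff.sum M fun k hk => (aff_ramp_a k hk).smul _
lemma aff_T_b : Aff (fun x => St M s (q x) (a x) (b x) (c x) x) (fun x => T M (b x)) :=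
  Aff.sum M fun k hk => (aff_ramp_b k hk).smul _
lemma aff_R_a : Aff (fun x => St M s (q x) (a x) (b x) (c x) x) (fun x => R M (a x)) :=
  (Aff.sum M fun k hk => (aff_ramp_a k hk).smul _).smul _
lemma aff_R_b : Aff (fun x => St M s (q x) (a x) (b x) (c x) x) (fun x => R M (b x)) :=
  (Aff.sum M fun k hk => (aff_ramp_b k hk).smul _).smul _
end

def Load (M s : ℕ) (P : (Fin s → ℝ) → ℝ) : (Fin s → ℝ) → Idx M s → ℝ :=
  fun x => St M s 0 0 0 (P x) x

def Beta (M s k : ℕ) (P X : (Fin s → ℝ) → ℝ) : (Fin s → ℝ) → Idx M s → ℝ :=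
  fun x => St M s 0 ((T M)^[k] (|P x + X x| / 2)) ((T M)^[k] (|P x - X x| / 2))
    ((|P x + X x| / 2 - |P x - X x| / 2) -
      (S M k (|P x + X x| / 2) - S M k (|P x - X x| / 2))) x

lemma beta_aff (M s k : ℕ) (P X : (Fin s → ℝ) → ℝ) :
    Aff (Beta M s k P X) (fun x => prod2 M (k+1) (P x) (X x)) := by
  refine (aff_c.sub ((aff_R_a.sub aff_R_b).smul ((((M:ℝ)^2)⁻¹)^k))).congr fun x => ?_
  unfold prod2
  have : ∀ z, S M (k+1) z = S M k z + (((M:ℝ)^2)⁻¹)^k * R M ((T M)^[k] z) := by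
    intro z; unfold S; rw [Finset.sum_range_succ]
  rw [this, this]; ring

lemma beta_net (M s D : ℕ) (P : (Fin s → ℝ) → ℝ) (i : Fin s)
    (h : RNet s (Idx M s) D (Load M s P)) (k : ℕ) :
    RNet s (Idx M s) (D+2+k) (Beta M s k P (fun x => relu (x i))) := by
  induction k with
  | zero =>
    have h1 := St_step M s D _
      (fun x => ![P x + relu (x i), -(P x + relu (x i)), P x - relu (x i), -(P x - relu (x i))])
      _ _ _ (fun _ => 0) (fun _ => 0) (fun _ => 0) h
      (by
        intro l
        fin_cases l
        · exact aff_c.add (aff_x i)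
        · exact (aff_c.add (aff_x i)).neg
        · exact aff_c.sub (aff_x i)
        · exact (aff_c.sub (aff_x i)).neg)
      (Aff.const 0) (Aff.const 0) (Aff.const 0)
    have aa : Aff (fun x => St M s ![P x + relu (x i), -(P x + relu (x i)), P x - relu (x i),
        -(P x - relu (x i))] 0 0 0 x) (fun x => |P x + relu (x i)| / 2) := by
      refine (((Aff.coord (.inl 0)).add (Aff.coord (.inl 1))).smul (1/2)).congr fun x => ?_
      simp only [St, pre]
      rw [← relu_add_neg]
      simp
      ring
    have ab : Aff (fun x => St M s ![P x + relu (x i), -(P x + relu (x i)), P x - relu (x i),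
        -(P x - relu (x i))] 0 0 0 x) (fun x => |P x - relu (x i)| / 2) := by
      refine (((Aff.coord (.inl 2)).add (Aff.coord (.inl 3))).smul (1/2)).congr fun x => ?_
      simp only [St, pre]
      rw [← relu_add_neg]
      simp
      ring
    have h2 := St_step M s (D+1) _ (fun _ => 0) _ _ _ _ _ _ h1 (fun l => Aff.const 0) aa ab
      (aa.sub ab)
    convert h2 using 1
    funext x
    simp [Beta, S]
  | succ k ih =>
    have h2 := St_step M s (D+2+k) _ (fun _ => 0) _ _ _ _ _ _ ih (fun l => Aff.const 0)
      aff_T_a aff_T_b (beta_aff M s k P _)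
    show RNet s (Idx M s) (D+2+k+1) _
    convert h2 using 1
    funext x
    simp only [Beta, Function.iterate_succ_apply', prod2]

lemma load_net (M s k : ℕ) (hs : 0 < s) (i : ℕ) (hi : i < s) :
    RNet s (Idx M s) (1 + i * (k+3)) (Load M s (fun x => Pn M (k+1) (ext0 x) i)) := by
  induction i with
  | zero =>
    have := RNet.first (d := s) (κ := Idx M s) (fun l x => pre M s 0 0 0 (x ⟨0, hs⟩) x l) (by
      have hx : ∀ j, Aff (fun x : Fin s → ℝ => x) (fun x => x j) :=
        fun j => Aff.coord (F := fun x : Fin s → ℝ => x) j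
      rintro (l | ((j | j) | (l | j)))
      · exact Aff.const _
      · exact Aff.const _
      · exact Aff.const _
      · simp only [pre]
        split_ifs
        · exact hx _
        · exact (hx _).neg
      · exact hx j)
    simp only [Nat.zero_mul, Nat.add_zero]
    convert this using 1
    funext x l
    simp [Load, St, Pn, ext0, hs]
  | succ i ih =>
    have h1 := beta_net M s _ _ ⟨i+1, hi⟩ (ih (by omega)) k
    have h2 := St_step M s _ _ (fun _ => 0) _ _ _ (fun _ => 0) (fun _ => 0) _ h1
      (fun l => Aff.const 0) (Aff.const 0) (Aff.const 0) (beta_aff M s k _ _)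
    have e : 1 + (i+1) * (k+3) = 1 + i * (k+3) + 2 + k + 1 := by ring
    rw [e]
    convert h2 using 1
    funext x l
    simp only [Load, Pn, ext0, hi, dif_pos]

lemma prod_net (M s k N : ℕ) (hs : 2 ≤ s) (hN : 2 * M + 8 + s ≤ N) :
    IsReLUNet s N ((s-1)*(k+3)) (fun x => Pn M (k+1) (ext0 x) (s-1)) := by
  obtain ⟨t, rfl⟩ : ∃ t, s = t + 2 := ⟨s - 2, by omega⟩
  have h1 := beta_net M (t+2) _ _ ⟨t+1, by omega⟩ (load_net M (t+2) k (by omega) t (by omega)) k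
  have e : (t+2-1)*(k+3) = 1 + t * (k+3) + 2 + k := by
    have : t + 2 - 1 = t + 1 := by omega
    rw [this]; ring
  rw [e]
  refine h1.isNet ?_ ((beta_aff M (t+2) k _ _).congr fun x => ?_)
  · simp; omega
  · have : t + 2 - 1 = t + 1 := by omega
    rw [this]
    simp [Pn, ext0]

end MPN
namespace MPN

lemma foldr_der (d : ℕ) (α : Fin d → ℕ) (f : (Fin d → ℝ) → ℝ) (l : List (Fin d)) :
    ((l.map α).sum = 0 → l.foldr (fun i g => pDerIter d i (α i) g) f = f) ∧
    ((l.map α).sum = 1 → ∃ i, l.foldr (fun i g => pDerIter d i (α i) g) f = pDer d i f) := by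
  induction l with
  | nil => simp
  | cons a l ih =>
    simp only [List.map_cons, List.sum_cons, List.foldr_cons]
    constructor
    · intro h
      have h1 : α a = 0 := by omega
      rw [ih.1 (by omega), h1]; rfl
    · intro h
      rcases Nat.eq_zero_or_pos (α a) with h1 | h1
      · obtain ⟨i, hi⟩ := ih.2 (by omega)
        exact ⟨i, by rw [hi, h1]; rfl⟩
      · have h2 : α a = 1 := by omega
        exact ⟨a, by rw [ih.1 (by omega), h2]; rfl⟩

lemma mDer_cases (d : ℕ) (α : Fin d → ℕ) (h : ∑ i, α i ≤ 1) (f : (Fin d → ℝ) → ℝ) :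
    mDer d α f = f ∨ ∃ i, mDer d α f = pDer d i f := by
  rw [Fin.sum_univ_def] at h
  rcases Nat.eq_zero_or_pos ((List.finRange d).map α).sum with h1 | h1
  · exact Or.inl ((foldr_der d α f _).1 h1)
  · exact Or.inr ((foldr_der d α f _).2 (by omega))

lemma unitCube_open (d : ℕ) : IsOpen (unitCube d) :=
  isOpen_set_pi Set.finite_univ fun _ _ => isOpen_Ioo

lemma hasDerivAt_line {d : ℕ} (i : Fin d) {f : (Fin d → ℝ) → ℝ} {x : Fin d → ℝ}
    (hf : DifferentiableAt ℝ f x) :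
    HasDerivAt (fun t : ℝ => f (x + t • Pi.single i 1)) (pDer d i f x) 0 := by
  have := hf.hasFDerivAt.hasLineDerivAt (Pi.single i 1)
  exact this

lemma pDer_le {d : ℕ} (i : Fin d) {f : (Fin d → ℝ) → ℝ} {C : ℝ} (hC : 0 ≤ C)
    (hl : ∀ x ∈ unitCube d, ∀ y ∈ unitCube d, |f x - f y| ≤ C * ∑ j, |x j - y j|)
    (x : Fin d → ℝ) (hx : x ∈ unitCube d) : |pDer d i f x| ≤ C := by
  by_cases hf : DifferentiableAt ℝ f x
  · have h := hasDerivAt_line i hf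
    refine h.le_of_lip' hC ?_
    have hc : Filter.Tendsto (fun t : ℝ => x + t • (Pi.single i 1 : Fin d → ℝ)) (nhds 0)
        (nhds x) := by
      have : Continuous (fun t : ℝ => x + t • (Pi.single i 1 : Fin d → ℝ)) := by fun_prop
      simpa using this.tendsto 0
    filter_upwards [hc ((unitCube_open d).mem_nhds hx)] with t ht
    have := hl _ ht x hx
    have e : ∑ j, |(x + t • (Pi.single i 1 : Fin d → ℝ)) j - x j| = |t| := by
      rw [Finset.sum_eq_single i]
      · simp
      · intro b _ hb
        simp [hb]
      · simp
    rw [e] at this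
    simpa using this
  · unfold pDer
    rw [fderiv_zero_of_not_differentiableAt hf]
    simpa using hC

lemma sob_le {d : ℕ} {f : (Fin d → ℝ) → ℝ} {C : ℝ} (hC : 0 ≤ C)
    (hv : ∀ x ∈ unitCube d, |f x| ≤ C)
    (hl : ∀ x ∈ unitCube d, ∀ y ∈ unitCube d, |f x - f y| ≤ C * ∑ j, |x j - y j|) :
    sobNorm d 1 (unitCube d) f ≤ ENNReal.ofReal C := by
  refine iSup₂_le fun α hα => ?_
  rw [eLpNorm_exponent_top]
  apply eLpNormEssSup_le_of_ae_bound
  refine ae_restrict_of_forall_mem (unitCube_open d).measurableSet fun x hx => ?_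
  rcases mDer_cases d α hα f with h | ⟨i, h⟩
  · rw [h]; exact hv x hx
  · rw [h]; exact pDer_le i hC hl x hx

lemma pDer_zero {d : ℕ} {f : (Fin d → ℝ) → ℝ} {i j : Fin d} (hij : j ≠ i)
    (hf : ∀ x : Fin d → ℝ, x i = 0 → f x = 0) (x : Fin d → ℝ) (hx : x i = 0) :
    pDer d j f x = 0 := by
  by_cases h : DifferentiableAt ℝ f x
  · have h1 := hasDerivAt_line j h
    have e : (fun t : ℝ => f (x + t • Pi.single j 1)) = fun _ => 0 := by
      funext t
      apply hf
      simp [hx, hij.symm]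
    rw [e] at h1
    exact h1.unique (hasDerivAt_const 0 0)
  · unfold pDer
    rw [fderiv_zero_of_not_differentiableAt h]
    simp

lemma ext0_mem {s : ℕ} {x : Fin s → ℝ} (hx : x ∈ unitCube s) (i : ℕ) :
    0 ≤ ext0 x i ∧ ext0 x i ≤ 1 := by
  unfold ext0
  split_ifs with h
  · have := hx ⟨i, h⟩ (Set.mem_univ _)
    exact ⟨this.1.le, this.2.le⟩
  · norm_num

lemma Pi'_ext {s : ℕ} (hs : 2 ≤ s) (x : Fin s → ℝ) : Pi' (ext0 x) (s-1) = ∏ i, x i := by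
  unfold Pi'
  rw [Nat.sub_add_cancel (by omega), ← Fin.prod_univ_eq_prod_range]
  simp only [ext0_val]

lemma dist1_ext {s : ℕ} (hs : 2 ≤ s) (x y : Fin s → ℝ) :
    dist1 (ext0 x) (ext0 y) (s-1) = ∑ i, |x i - y i| := by
  unfold dist1
  rw [Nat.sub_add_cancel (by omega), ← Fin.sum_univ_eq_sum_range
    (fun j => |ext0 x j - ext0 y j|)]
  simp only [ext0_val]

lemma pow_bound (n : ℕ) (h : ℝ) (h0 : 0 ≤ h) (h1 : n * h ≤ 1) :
    (1 + h)^n - 1 ≤ 2 * (n * h) := by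
  have a : (1 + h)^n ≤ Real.exp (n * h) := by
    rw [Real.exp_nat_mul]
    apply pow_le_pow_left₀ (by linarith)
    linarith [Real.add_one_le_exp h]
  have hn : 0 ≤ n * h := by positivity
  have b := Real.abs_exp_sub_one_le (x := n * h) (by rwa [abs_of_nonneg hn])
  rw [abs_of_nonneg hn] at b
  linarith [le_abs_self (Real.exp (n*h) - 1)]

end MPN
/-- Proposition A.6: ReLU approximation of the `s`-fold product `x_1 ⋯ x_s`, vanishing with
its partial derivatives whenever some coordinate vanishes. -/
theorem multi_product_net (N L s : ℕ) (hN : 0 < N) (hL : 0 < L) (hs : 2 ≤ s) :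
    ∃ φ : (Fin s → ℝ) → ℝ,
      IsReLUNet s (9*(N+1)+s-1) (14*s*(s-1)*L) φ ∧
      sobNorm s 1 (unitCube s) φ ≤ ENNReal.ofReal 18 ∧
      sobNorm s 1 (unitCube s) (fun x => φ x - ∏ i, x i) ≤
        ENNReal.ofReal (10*((s:ℝ)-1) * ((N:ℝ)+1) ^ (-(7*(s:ℝ)*(L:ℝ)))) ∧
      ∀ (x : Fin s → ℝ) (i : Fin s), x i = 0 →
        φ x = 0 ∧ ∀ j : Fin s, j ≠ i → pDer s j φ x = 0 := by
  have hsL : s ≤ s * L := Nat.le_mul_of_pos_right s hL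
  obtain ⟨k, hk⟩ : ∃ k, 14 * (s * L) = k + 3 := ⟨14 * (s * L) - 3, by omega⟩
  have hM : 2 ≤ N + 1 := by omega
  have hM2 : (2:ℝ) ≤ ((N+1 : ℕ):ℝ) := by exact_mod_cast hM
  have hM0 : (0:ℝ) < ((N+1 : ℕ):ℝ) := by linarith
  -- the base accuracy
  set h : ℝ := ((((N+1 : ℕ):ℝ))⁻¹)^(k+1) with hh
  set h₀ : ℝ := ((N:ℝ)+1) ^ (-(7*(s:ℝ)*(L:ℝ))) with hh0
  have e0 : h₀ = ((((N+1 : ℕ):ℝ))⁻¹)^(7*(s*L)) := by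
    have : (7*(s:ℝ)*(L:ℝ)) = ((7*(s*L) : ℕ):ℝ) := by push_cast; ring
    rw [hh0, this, Real.rpow_neg (by positivity), Real.rpow_natCast, inv_pow]
    push_cast; rfl
  have hinv : (((N+1 : ℕ):ℝ))⁻¹ ≤ 1/2 := by
    rw [one_div]; exact inv_anti₀ (by norm_num) hM2
  have hinv0 : 0 ≤ (((N+1 : ℕ):ℝ))⁻¹ := by positivity
  have hpos : 0 ≤ h := by positivity
  have hle : h ≤ h₀ := by
    rw [e0]
    exact pow_le_pow_of_le_one hinv0 (by linarith) (by omega)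
  have hh1 : ((s-1:ℕ):ℝ) * h₀ ≤ 1 := by
    have a1 : h₀ ≤ (1/2)^s := by
      rw [e0]
      refine (pow_le_pow_left₀ hinv0 hinv _).trans ?_
      exact pow_le_pow_of_le_one (by norm_num) (by norm_num) (by omega)
    have a2 : ((s-1:ℕ):ℝ) ≤ 2^s := by
      have : s - 1 ≤ 2^s := by have := Nat.lt_two_pow_self (n := s); omega
      exact_mod_cast this
    calc ((s-1:ℕ):ℝ) * h₀ ≤ 2^s * (1/2)^s :=
          mul_le_mul a2 a1 (hpos.trans hle) (by positivity)
      _ = 1 := by rw [← mul_pow]; norm_num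
  have hsc : ((s-1:ℕ):ℝ) = (s:ℝ) - 1 := by rw [Nat.cast_sub (by omega)]; simp
  set n : ℝ := ((s-1:ℕ):ℝ) with hn
  have hn0 : 0 ≤ n := by positivity
  have hnh : n * h ≤ n * h₀ := mul_le_mul_of_nonneg_left hle hn0
  have hnh0 : 0 ≤ n * h := by positivity
  have hG := MPN.pow_bound (s-1) h hpos (hnh.trans hh1)
  rw [← hn] at hG
  have hzero : ∀ (x : Fin s → ℝ) (i : Fin s), x i = 0 →
      MPN.Pn (N+1) (k+1) (MPN.ext0 x) (s-1) = 0 := fun x i hx =>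
    MPN.Pn_zero _ _ _ i _ (by rw [MPN.ext0_val, hx]) (by omega)
  have hval : ∀ x ∈ unitCube s,
      |MPN.Pn (N+1) (k+1) (MPN.ext0 x) (s-1) - ∏ i, x i| ≤ n * h := by
    intro x hx
    rw [← MPN.Pi'_ext hs]
    exact MPN.Pn_err hM (k+1) (MPN.ext0_mem hx) (s-1)
  have hlip : ∀ x ∈ unitCube s, ∀ y ∈ unitCube s,
      |(MPN.Pn (N+1) (k+1) (MPN.ext0 x) (s-1) - ∏ i, x i) -
        (MPN.Pn (N+1) (k+1) (MPN.ext0 y) (s-1) - ∏ i, y i)| ≤ (2 * (n * h)) * ∑ j, |x j - y j| := by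
    intro x hx y hy
    rw [← MPN.Pi'_ext hs, ← MPN.Pi'_ext hs, ← MPN.dist1_ext hs]
    exact (MPN.Pn_err_lip hM (k+1) (MPN.ext0_mem hx) (MPN.ext0_mem hy) (s-1)).trans
      (mul_le_mul_of_nonneg_right hG (MPN.dist1_nonneg _ _ _))
  have hsum : ∀ x y : Fin s → ℝ, 0 ≤ ∑ j, |x j - y j| :=
    fun x y => Finset.sum_nonneg fun _ _ => abs_nonneg _
  refine ⟨fun x => MPN.Pn (N+1) (k+1) (MPN.ext0 x) (s-1), ?_, ?_, ?_, ?_⟩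
  · have e : 14*s*(s-1)*L = (s-1)*(k+3) := by rw [← hk]; ring
    rw [e]
    exact MPN.prod_net (N+1) s k _ hs (by omega)
  · refine MPN.sob_le (by norm_num) (fun x hx => ?_) (fun x hx y hy => ?_)
    · have := MPN.Pn_mem hM (k+1) (MPN.ext0_mem hx) (s-1)
      rw [abs_of_nonneg this.1]; linarith [this.2]
    · have h1 := hlip x hx y hy
      have h2 := MPN.Pi'_lip (MPN.ext0_mem hx) (MPN.ext0_mem hy) (s-1)
      rw [MPN.Pi'_ext hs, MPN.Pi'_ext hs, MPN.dist1_ext hs] at h2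
      have h3 := abs_add_le ((MPN.Pn (N+1) (k+1) (MPN.ext0 x) (s-1) - ∏ i, x i) -
        (MPN.Pn (N+1) (k+1) (MPN.ext0 y) (s-1) - ∏ i, y i)) (∏ i, x i - ∏ i, y i)
      have e : ((MPN.Pn (N+1) (k+1) (MPN.ext0 x) (s-1) - ∏ i, x i) -
        (MPN.Pn (N+1) (k+1) (MPN.ext0 y) (s-1) - ∏ i, y i)) + (∏ i, x i - ∏ i, y i) =
        MPN.Pn (N+1) (k+1) (MPN.ext0 x) (s-1) - MPN.Pn (N+1) (k+1) (MPN.ext0 y) (s-1) := by ring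
      rw [e] at h3
      have h4 : (2 * (n * h)) * ∑ j, |x j - y j| ≤ 2 * ∑ j, |x j - y j| :=
        mul_le_mul_of_nonneg_right (by linarith) (hsum x y)
      linarith [hsum x y]
  · rw [← hsc]
    refine MPN.sob_le (by linarith) (fun x hx => ?_) (fun x hx y hy => ?_)
    · linarith [hval x hx]
    · exact (hlip x hx y hy).trans (mul_le_mul_of_nonneg_right (by linarith) (hsum x y))
  · intro x i hx
    exact ⟨hzero x i hx, fun j hj => MPN.pDer_zero hj (fun y hy => hzero y i hy) x hx⟩

end
end

section
/- Let n ≥ 1, f ∈ W^{n,∞}((0,1)^d), x₀ ∈ (0,1)^d and r > 0 be such that the closed Euclidean ball B := B_r(x₀) is a compact subset of (0,1)^d. Then the averaged Taylor polynomial of order n of f over B can be written as Q^n f(x) = Σ_{|α|≤n−1} c_{f,α} x^α, and the coefficients satisfy |c_{f,α}| ≤ C₂(n,d)·‖f‖_{W^{n−1,∞}(B)}, where C₂(n,d) = Σ_{|α+β|≤n−1} 1/(α! β!). -/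
open MeasureTheory ENNReal

noncomputable section

lemma aux_mem (d k : ℕ) (α : Fin d → ℕ) : α ∈ MIdx d k ↔ ∑ i, α i ≤ k := by
  unfold MIdx
  simp only [Finset.mem_filter, Fintype.mem_piFinset, Finset.mem_range, and_iff_right_iff_imp]
  intro h i
  have := Finset.single_le_sum (f := α) (fun i _ => Nat.zero_le _) (Finset.mem_univ i)
  omega

lemma aux_pow (m : ℕ) (x y : ℝ) : (1 / (m.factorial : ℝ)) * (x - y) ^ m =
    ∑ k ∈ Finset.range (m+1), (1 / ((k.factorial : ℝ) * ((m - k).factorial : ℝ))) * x ^ k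
      * (-y) ^ (m - k) := by
  rw [sub_eq_add_neg, add_pow, Finset.mul_sum]
  refine Finset.sum_congr rfl fun k hk => ?_
  have hk' : k ≤ m := by simpa [Nat.lt_succ_iff] using hk
  rw [Nat.cast_choose ℝ hk']
  have := Nat.factorial_ne_zero m
  field_simp

open Classical in
lemma aux_binom (d K : ℕ) (α : Fin d → ℕ) (hα : α ∈ MIdx d K) (x y : Fin d → ℝ) :
    (1/(mfact d α : ℝ)) * ∏ j, (x j - y j) ^ (α j) =
      ∑ γ ∈ MIdx d K, if γ ≤ α then
        (1 / ((mfact d γ : ℝ) * (mfact d (α - γ) : ℝ))) * mono d γ x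
          * ∏ j, (-y j) ^ (α j - γ j) else 0 := by
  have h1 : (1/(mfact d α : ℝ)) * ∏ j, (x j - y j) ^ (α j)
      = ∏ j, ((1 / ((α j).factorial : ℝ)) * (x j - y j) ^ α j) := by
    rw [Finset.prod_mul_distrib]
    simp [mfact]
  rw [h1, Finset.prod_congr rfl (fun j _ => aux_pow (α j) (x j) (y j)), Finset.prod_univ_sum,
    ← Finset.sum_filter]
  have h2 : (MIdx d K).filter (fun γ => γ ≤ α)
      = Fintype.piFinset fun j => Finset.range (α j + 1) := by
    ext γ
    simp only [Finset.mem_filter, aux_mem, Fintype.mem_piFinset, Finset.mem_range,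
      Nat.lt_succ_iff, Pi.le_def]
    constructor
    · exact fun h => h.2
    · intro h
      exact ⟨(Finset.sum_le_sum fun i _ => h i).trans ((aux_mem d K α).1 hα), h⟩
  rw [h2]
  refine Finset.sum_congr rfl fun γ _ => ?_
  simp [mfact, mono, Finset.prod_mul_distrib]

lemma aux_aesm (d : ℕ) (Ω : Set (Fin d → ℝ)) (g : (Fin d → ℝ) → ℝ)
    (h : ∀ᵐ x ∂(volume.restrict Ω), DifferentiableAt ℝ g x) :
    AEStronglyMeasurable g (volume.restrict Ω) := by
  have hC : MeasurableSet {x | ContinuousAt g x} := (IsGδ.setOfPred_continuousAt g).measurableSet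
  have h1 : ContinuousOn g {x | ContinuousAt g x} := fun x hx => ContinuousAt.continuousWithinAt hx
  have h2 : AEStronglyMeasurable g ((volume.restrict Ω).restrict {x | ContinuousAt g x}) :=
    h1.aestronglyMeasurable hC
  rwa [Measure.restrict_eq_self_of_ae_mem] at h2
  exact h.mono fun x hx => hx.continuousAt

lemma aux_bump_nonneg (d : ℕ) (x₀ : Fin d → ℝ) (r : ℝ) (x) : 0 ≤ bumpW d x₀ r x := by
  unfold bumpW; split_ifs <;> positivity

lemma aux_bump_le (d : ℕ) (x₀ : Fin d → ℝ) (r : ℝ) (hr : 0 < r) (x) : bumpW d x₀ r x ≤ 1 := by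
  unfold bumpW
  split_ifs with h
  · rw [Real.exp_le_one_iff, neg_nonpos, inv_nonneg, sub_nonneg]
    have h1 : Real.sqrt (∑ i, (x i - x₀ i)^2) / r ≤ 1 := by
      rw [div_le_one hr]; exact h.le
    exact pow_le_one₀ (by positivity) h1
  · exact zero_le_one

lemma aux_bump_meas (d : ℕ) (x₀ : Fin d → ℝ) (r : ℝ) : Measurable (bumpW d x₀ r) := by
  unfold bumpW
  refine Measurable.ite ?_ (by fun_prop) (by fun_prop)
  exact measurableSet_lt (by fun_prop) (by fun_prop)

lemma aux_eball_meas (d : ℕ) (x₀ : Fin d → ℝ) (r : ℝ) : MeasurableSet (eball d x₀ r) :=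
  measurableSet_le (by fun_prop) (by fun_prop)

lemma aux_bump_int (d : ℕ) (x₀ : Fin d → ℝ) (r : ℝ) (hr : 0 < r)
    (hB : eball d x₀ r ⊆ unitCube d) : Integrable (bumpW d x₀ r) := by
  have hv : volume (eball d x₀ r) ≠ ⊤ := by
    refine ne_top_of_le_ne_top ?_ (measure_mono hB)
    simp [unitCube, Real.volume_pi_Ioo, volume_pi, Measure.pi_pi]
  have hi : Integrable ((eball d x₀ r).indicator fun _ => (1:ℝ)) :=
    (integrable_indicator_iff (aux_eball_meas d x₀ r)).2 (integrableOn_const hv)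
  refine hi.mono' (aux_bump_meas d x₀ r).aestronglyMeasurable (Filter.Eventually.of_forall ?_)
  intro x
  rw [Real.norm_of_nonneg (aux_bump_nonneg d x₀ r x)]
  by_cases hx : x ∈ eball d x₀ r
  · simpa [hx] using aux_bump_le d x₀ r hr x
  · have : ¬ Real.sqrt (∑ i, (x i - x₀ i)^2) < r := fun h => hx h.le
    simp [hx, bumpW, this]

/-- Lemma A.13: the averaged Taylor polynomial `Q^n f` is a polynomial
`Σ_{|α|≤n−1} c_{f,α} x^α` with `|c_{f,α}| ≤ C₂(n,d) ‖f‖_{W^{n−1,∞}(B)}`,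
where `C₂(n,d) = Σ_{|α+β|≤n−1} 1/(α!β!)`. -/
theorem averaged_taylor_coeff (d n : ℕ) (hd : 0 < d) (hn : 1 ≤ n)
    (f : (Fin d → ℝ) → ℝ) (hf : MemW d n (unitCube d) f)
    (x₀ : Fin d → ℝ) (hx₀ : x₀ ∈ unitCube d) (r : ℝ) (hr : 0 < r)
    (hB : eball d x₀ r ⊆ unitCube d) :
    ∃ c : (Fin d → ℕ) → ℝ,
      (∀ x : Fin d → ℝ,
        QTaylor d n f x₀ r x = ∑ α ∈ MIdx d (n-1), c α * mono d α x) ∧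
      ∀ α ∈ MIdx d (n-1),
        |c α| ≤
          (∑ p ∈ ((MIdx d (n-1)) ×ˢ (MIdx d (n-1))).filter
              (fun p => ∑ i, (p.1 i + p.2 i) ≤ n - 1),
            (1:ℝ) / ((mfact d p.1 : ℝ) * (mfact d p.2 : ℝ)))
          * (sobNorm d (n-1) (eball d x₀ r) f).toReal := by
  classical
  have hbW := aux_bump_int d x₀ r hr hB
  have hbN : Integrable (bumpN d x₀ r) := hbW.div_const _
  have hbN0 : ∀ y, 0 ≤ bumpN d x₀ r y := fun y =>
    div_nonneg (aux_bump_nonneg d x₀ r y) (integral_nonneg fun y => aux_bump_nonneg d x₀ r y)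
  have hbN1 : ∫ y in eball d x₀ r, bumpN d x₀ r y ≤ 1 := by
    refine (setIntegral_le_integral hbN (Filter.Eventually.of_forall hbN0)).trans ?_
    unfold bumpN
    rw [integral_div]
    exact div_self_le_one _
  set B := eball d x₀ r with hBdef
  have hBm : MeasurableSet B := aux_eball_meas d x₀ r
  set S := sobNorm d (n-1) B f with hS
  have hSfin : S ≠ ⊤ := by
    refine ne_top_of_le_ne_top hf.2 ?_
    refine iSup₂_le fun α hα => ?_
    refine (eLpNorm_mono_measure _ (Measure.restrict_mono hB le_rfl)).trans ?_
    exact le_iSup₂ (f := fun (α : Fin d → ℕ) (_ : ∑ i, α i ≤ n) =>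
      eLpNorm (mDer d α f) ⊤ (volume.restrict (unitCube d))) α (by omega)
  -- a.e. bound and measurability
  have hmeas : ∀ α ∈ MIdx d (n-1), AEStronglyMeasurable (mDer d α f) (volume.restrict B) := by
    intro α hα
    rw [aux_mem] at hα
    exact (aux_aesm d _ _ (hf.1 α (by omega))).mono_measure (Measure.restrict_mono hB le_rfl)
  have hbd : ∀ α ∈ MIdx d (n-1), ∀ᵐ y ∂(volume.restrict B), |mDer d α f y| ≤ S.toReal := by
    intro α hα
    rw [aux_mem] at hα
    have h1 : eLpNorm (mDer d α f) ⊤ (volume.restrict B) ≤ S :=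
      le_iSup₂ (f := fun (α : Fin d → ℕ) (_ : ∑ i, α i ≤ n - 1) =>
        eLpNorm (mDer d α f) ⊤ (volume.restrict B)) α hα
    rw [eLpNorm_exponent_top] at h1
    filter_upwards [ae_le_eLpNormEssSup (f := mDer d α f) (μ := volume.restrict B)] with y hy
    have h2 := ENNReal.toReal_mono hSfin (hy.trans h1)
    simpa using h2
  have hmono : ∀ (β : Fin d → ℕ), ∀ y ∈ B, |∏ j, (-y j) ^ β j| ≤ 1 := by
    intro β y hy
    rw [Finset.abs_prod]
    refine Finset.prod_le_one (fun _ _ => abs_nonneg _) fun j _ => ?_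
    have := hB hy j (Set.mem_univ j)
    rw [abs_pow, abs_neg]
    exact pow_le_one₀ (abs_nonneg _) (abs_le.2 ⟨by linarith [this.1], this.2.le⟩)
  let G : (Fin d → ℕ) → (Fin d → ℕ) → (Fin d → ℝ) → ℝ := fun α γ y =>
    (mDer d α f y * ∏ j, (-y j) ^ (α j - γ j)) * bumpN d x₀ r y
  have hGb : ∀ α ∈ MIdx d (n-1), ∀ γ, ∀ᵐ y ∂(volume.restrict B),
      ‖G α γ y‖ ≤ S.toReal * bumpN d x₀ r y := by
    intro α hα γ
    filter_upwards [hbd α hα, ae_restrict_mem hBm] with y hy hyB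
    simp only [G, Real.norm_eq_abs, abs_mul, abs_of_nonneg (hbN0 y)]
    refine mul_le_mul_of_nonneg_right ?_ (hbN0 y)
    calc _ ≤ S.toReal * 1 := mul_le_mul hy (hmono (fun j => α j - γ j) y hyB) (abs_nonneg _)
            ENNReal.toReal_nonneg
      _ = _ := mul_one _
  have hbS : Integrable (fun y => S.toReal * bumpN d x₀ r y) (volume.restrict B) :=
    (hbN.restrict).const_mul _
  have hGi : ∀ α ∈ MIdx d (n-1), ∀ γ, Integrable (G α γ) (volume.restrict B) := by
    intro α hα γ
    refine hbS.mono' ?_ (hGb α hα γ)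
    refine ((hmeas α hα).mul ?_).mul hbN.restrict.aestronglyMeasurable
    exact Continuous.aestronglyMeasurable (by fun_prop)
  have hGle : ∀ α ∈ MIdx d (n-1), ∀ γ, |∫ y in B, G α γ y| ≤ S.toReal := by
    intro α hα γ
    rw [← Real.norm_eq_abs]
    refine (norm_integral_le_of_norm_le hbS (hGb α hα γ)).trans ?_
    rw [integral_const_mul]
    exact mul_le_of_le_one_right ENNReal.toReal_nonneg hbN1
  refine ⟨fun γ => ∑ α ∈ MIdx d (n-1), if γ ≤ α then
    (1 / ((mfact d γ : ℝ) * (mfact d (α - γ) : ℝ))) * ∫ y in B, G α γ y else 0, ?_, ?_⟩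
  · intro x
    have hT : ∀ y, taylorPoly d n f y x * bumpN d x₀ r y =
        ∑ α ∈ MIdx d (n-1), ∑ γ ∈ MIdx d (n-1),
          (if γ ≤ α then (1 / ((mfact d γ : ℝ) * (mfact d (α - γ) : ℝ))) * mono d γ x else 0)
            * G α γ y := by
      intro y
      unfold taylorPoly
      rw [Finset.sum_mul]
      refine Finset.sum_congr rfl fun α hα => ?_
      rw [show (1/(mfact d α : ℝ)) * mDer d α f y * ∏ j, (x j - y j) ^ (α j)
        = ((1/(mfact d α : ℝ)) * ∏ j, (x j - y j) ^ (α j)) * mDer d α f y by ring,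
        aux_binom d (n-1) α hα, Finset.sum_mul, Finset.sum_mul]
      refine Finset.sum_congr rfl fun γ _ => ?_
      split_ifs
      · simp only [G]; ring
      · simp
    unfold QTaylor
    simp_rw [hT]
    rw [integral_finsetSum _ (fun α hα => integrable_finsetSum _ fun γ _ =>
      (hGi α hα γ).const_mul _)]
    simp_rw [Finset.sum_mul]
    rw [Finset.sum_comm (s := MIdx d (n-1)) (t := MIdx d (n-1)) (f := fun γ α =>
      (if γ ≤ α then (1 / ((mfact d γ : ℝ) * (mfact d (α - γ) : ℝ))) * ∫ y in B, G α γ y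
        else 0) * mono d γ x)]
    refine Finset.sum_congr rfl fun α hα => ?_
    rw [integral_finsetSum _ (fun γ _ => (hGi α hα γ).const_mul _)]
    refine Finset.sum_congr rfl fun γ _ => ?_
    rw [integral_const_mul]
    split_ifs
    · ring
    · simp
  · intro γ hγ
    beta_reduce
    rw [← Finset.sum_filter]
    refine (Finset.abs_sum_le_sum_abs _ _).trans ?_
    calc _ ≤ ∑ α ∈ (MIdx d (n-1)).filter (fun α => γ ≤ α),
          (1 / ((mfact d γ : ℝ) * (mfact d (α - γ) : ℝ))) * S.toReal := by
          refine Finset.sum_le_sum fun α hα => ?_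
          have h0 : (0:ℝ) ≤ 1 / ((mfact d γ : ℝ) * (mfact d (α - γ) : ℝ)) := by positivity
          rw [abs_mul, abs_of_nonneg h0]
          exact mul_le_mul_of_nonneg_left (hGle α (Finset.mem_filter.1 hα).1 γ) h0
      _ ≤ _ := by
          rw [← Finset.sum_mul]
          refine mul_le_mul_of_nonneg_right ?_ ENNReal.toReal_nonneg
          have hinj : Set.InjOn (fun α : Fin d → ℕ => (γ, α - γ))
              ((MIdx d (n-1)).filter (fun α => γ ≤ α) : Finset (Fin d → ℕ)) := by
            intro a ha b hb hab
            have ha' := (Finset.mem_filter.1 (Finset.mem_coe.1 ha)).2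
            have hb' := (Finset.mem_filter.1 (Finset.mem_coe.1 hb)).2
            have h := (Prod.ext_iff.1 hab).2
            funext i
            have h1 := congrFun h i
            have h2 : γ i ≤ a i := ha' i
            have h3 : γ i ≤ b i := hb' i
            simp only [Pi.sub_apply] at h1
            omega
          rw [← Finset.sum_image (s := (MIdx d (n-1)).filter (fun α => γ ≤ α))
            (g := fun α : Fin d → ℕ => (γ, α - γ))
            (f := fun p => (1:ℝ) / ((mfact d p.1 : ℝ) * (mfact d p.2 : ℝ))) hinj]
          refine Finset.sum_le_sum_of_subset_of_nonneg ?_ (fun _ _ _ => by positivity)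
          intro p hp
          obtain ⟨α, hα, rfl⟩ := Finset.mem_image.1 hp
          obtain ⟨hα1, hα2⟩ := Finset.mem_filter.1 hα
          have e : ∀ i, γ i + (α - γ) i = α i := fun i => by
            have : γ i ≤ α i := hα2 i
            simp only [Pi.sub_apply]; omega
          rw [aux_mem] at hα1
          simp only [Finset.mem_filter, Finset.mem_product, e]
          refine ⟨⟨hγ, (aux_mem _ _ _).2 ?_⟩, hα1⟩
          refine (Finset.sum_le_sum fun i _ => ?_).trans hα1
          exact Nat.sub_le _ _


end
end
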